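/- Assume log ρ₁ / log ρₙ ∈ ℚ. If every touching letter of the touching IFS {Ψᵢ} is substitutable, then D and T are Lipschitz equivalent. -/

import Mathlib

noncomputable section

open Set Metric MeasureTheory

/-- Distance between two sets. -/
def setDist {X : Type*} [MetricSpace X] (A B : Set X) : ℝ := sInf (Set.image2 dist A B)

/-- Lipschitz equivalence of two sets: a bi-Lipschitz bijection between them. -/
def LipEquivOn {X Y : Type*} [MetricSpace X] [MetricSpace Y] (E : Set X) (F : Set Y) : Prop :=
  ∃ (f : X → Y) (c c' : ℝ), 0 < c ∧ c ≤ c' ∧ Set.BijOn f E F ∧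
    ∀ x ∈ E, ∀ y ∈ E, c * dist x y ≤ dist (f x) (f y) ∧ dist (f x) (f y) ≤ c' * dist x y

/-- The affine contraction `x ↦ ρ i * x + t i`. -/
def affMap (r t : ℕ → ℝ) (i : ℕ) (x : ℝ) : ℝ := r i * x + t i

/-- Composition of the affine maps along a word (first letter outermost). -/
def affWord (r t : ℕ → ℝ) : List ℕ → ℝ → ℝ
  | [] => id
  | i :: w => affMap r t i ∘ affWord r t w

/-- Cylinder of a general IFS for a word over `Fin n`. -/
def cylW {X : Type*} {n : ℕ} (Ψ : Fin n → X → X) (F : Set X) (w : List (Fin n)) : Set X :=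
  (w.foldr (fun i g => Ψ i ∘ g) id) '' F

/-- A (separable) contraction vector `(ρ 0, …, ρ (n-1))` in `ℝ`. -/
structure ContractionVec (n : ℕ) (ρ : ℕ → ℝ) : Prop where
  three_le : 3 ≤ n
  pos : ∀ i, i < n → 0 < ρ i
  lt_one : ∀ i, i < n → ρ i < 1
  sum_lt : (∑ i ∈ Finset.range n, ρ i) < 1

/-- The touching IFS of the standing setup, together with its attractor `T`. -/
structure TouchingIFS (n : ℕ) (ρ : ℕ → ℝ) where
  t : ℕ → ℝ
  T : Set ℝ
  order : ∀ i, i + 1 < n → affMap ρ t i 1 ≤ affMap ρ t (i + 1) 0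
  left0 : affMap ρ t 0 0 = 0
  right1 : affMap ρ t (n - 1) 1 = 1
  touch_ex : ∃ i, i + 1 < n ∧ affMap ρ t i 1 = affMap ρ t (i + 1) 0
  compactT : IsCompact T
  nonemptyT : T.Nonempty
  invT : T = ⋃ i ∈ Finset.range n, affMap ρ t i '' T

/-- The dust-like, equally spaced IFS of the standing setup, with attractor `D`. -/
structure DustIFS (n : ℕ) (ρ : ℕ → ℝ) where
  d : ℕ → ℝ
  D : Set ℝ
  left0 : affMap ρ d 0 0 = 0
  right1 : affMap ρ d (n - 1) 1 = 1
  equal_gap : ∀ i, i + 1 < n →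
    affMap ρ d (i + 1) 0 - affMap ρ d i 1 = (1 - ∑ j ∈ Finset.range n, ρ j) / (n - 1)
  compactD : IsCompact D
  nonemptyD : D.Nonempty
  invD : D = ⋃ i ∈ Finset.range n, affMap ρ d i '' D

variable {n : ℕ} {ρ : ℕ → ℝ}

/-- Cylinder `T_w`. -/
def TouchingIFS.cyl (S : TouchingIFS n ρ) (w : List ℕ) : Set ℝ := affWord ρ S.t w '' S.T

/-- `i` is a (left) touching letter. -/
def TouchingIFS.touch (S : TouchingIFS n ρ) (i : ℕ) : Prop :=
  i + 1 < n ∧ affMap ρ S.t i 1 = affMap ρ S.t (i + 1) 0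

/-- Left touching patch `L_k(T_w)` (with `α` the initial touching run length). -/
def TouchingIFS.patchL (S : TouchingIFS n ρ) (α : ℕ) (w : List ℕ) (k : ℕ) : Set ℝ :=
  ⋃ j ∈ Finset.range α, S.cyl (w ++ List.replicate k 0 ++ [j])

/-- Right touching patch `R_k(T_w)` (with `β` the final touching run length). -/
def TouchingIFS.patchR (S : TouchingIFS n ρ) (β : ℕ) (w : List ℕ) (k : ℕ) : Set ℝ :=
  ⋃ j ∈ Finset.Ico (n - β) n, S.cyl (w ++ List.replicate k (n - 1) ++ [j])

/-- `α` is the number of successive touching intervals at the beginning. -/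
def TouchingIFS.alphaRun (S : TouchingIFS n ρ) (α : ℕ) : Prop :=
  1 ≤ α ∧ α < n ∧ (∀ i, i + 1 < α → S.touch i) ∧ ¬ S.touch (α - 1)

/-- `β` is the number of successive touching intervals at the end. -/
def TouchingIFS.betaRun (S : TouchingIFS n ρ) (β : ℕ) : Prop :=
  1 ≤ β ∧ β < n ∧ (∀ i, n - β ≤ i → i + 1 < n → S.touch i) ∧ ¬ S.touch (n - β - 1)

/-- Cylinder `D_w`. -/
def DustIFS.cyl (Q : DustIFS n ρ) (w : List ℕ) : Set ℝ := affWord ρ Q.d w '' Q.D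

/-- Left patch `L_k(D_w)`. -/
def DustIFS.patchL (Q : DustIFS n ρ) (α : ℕ) (w : List ℕ) (k : ℕ) : Set ℝ :=
  ⋃ j ∈ Finset.range α, Q.cyl (w ++ List.replicate k 0 ++ [j])

/-- Right patch `R_k(D_w)`. -/
def DustIFS.patchR (Q : DustIFS n ρ) (β : ℕ) (w : List ℕ) (k : ℕ) : Set ℝ :=
  ⋃ j ∈ Finset.Ico (n - β) n, Q.cyl (w ++ List.replicate k (n - 1) ++ [j])

/-- `τ k` is the unique positive integer with `ρₙᵏ ρ₁ < ρ₁ ^ τ(k) ≤ ρₙᵏ`. -/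
def tauSpec (ρ : ℕ → ℝ) (n : ℕ) (τ : ℕ → ℕ) : Prop :=
  ∀ k, 1 ≤ k → 1 ≤ τ k ∧ ρ (n - 1) ^ k * ρ 0 < ρ 0 ^ τ k ∧ ρ 0 ^ τ k ≤ ρ (n - 1) ^ k

/-- `Cᵏ = R_k(T_{i₀}) ∪ L_{τ(k)}(T_{i₀+1})`. -/
def Cset (S : TouchingIFS n ρ) (α β i₀ : ℕ) (τ : ℕ → ℕ) (k : ℕ) : Set ℝ :=
  S.patchR β [i₀] k ∪ S.patchL α [i₀ + 1] (τ k)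

/-- The touching letter `i` is left substitutable. -/
def TouchingIFS.LeftSub (S : TouchingIFS n ρ) (α : ℕ) (i : ℕ) : Prop :=
  ∃ (w : List ℕ) (a : ℕ) (k k' : ℕ), (∀ b ∈ w ++ [a], b < n) ∧
    Metric.diam (S.patchL α [i + 1] k) = Metric.diam (S.patchL α (i :: (w ++ [a])) k') ∧
    a ≠ 0 ∧ ∀ ℓ, S.touch ℓ → a ≠ ℓ + 1

/-- The touching letter `i` is right substitutable. -/
def TouchingIFS.RightSub (S : TouchingIFS n ρ) (β : ℕ) (i : ℕ) : Prop :=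
  ∃ (w : List ℕ) (a : ℕ) (k k' : ℕ), (∀ b ∈ w ++ [a], b < n) ∧
    Metric.diam (S.patchR β [i] k) = Metric.diam (S.patchR β ((i + 1) :: (w ++ [a])) k') ∧
    a ≠ n - 1 ∧ ¬ S.touch a

/-- Convex hull of a bounded set of reals: the minimal closed interval containing it. -/
def CH (B : Set ℝ) : Set ℝ := Set.Icc (sInf B) (sSup B)

/-- `[a,b]` is a maximal run of touching letters (a first-level connected component). -/
def TouchingIFS.run (S : TouchingIFS n ρ) (a b : ℕ) : Prop :=
  a ≤ b ∧ b < n ∧ (∀ i, a ≤ i → i < b → S.touch i) ∧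
  (a = 0 ∨ ¬ S.touch (a - 1)) ∧ (b = n - 1 ∨ ¬ S.touch b)

/-- Membership in the class `𝒯⁽¹⁾`: a `T`-separate copy `Ψ_w(T⁽¹⁾_j)`. -/
def TouchingIFS.T1mem (S : TouchingIFS n ρ) (X : Set ℝ) : Prop :=
  ∃ (w : List ℕ) (a b : ℕ), (∀ c ∈ w, c < n) ∧ S.run a b ∧
    X = affWord ρ S.t w '' (⋃ j ∈ Finset.Icc a b, S.cyl [j]) ∧
    0 < setDist X (S.T \ X)

/-- Membership in the class `𝒯⁽²⁾`: a copy `Ψ_w(T⁽²⁾_i) = Ψ_w(R₀(T_i) ∪ L₀(T_{i+1}))`. -/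
def TouchingIFS.T2mem (S : TouchingIFS n ρ) (α β : ℕ) (X : Set ℝ) : Prop :=
  ∃ (w : List ℕ) (i : ℕ), (∀ c ∈ w, c < n) ∧ S.touch i ∧
    X = affWord ρ S.t w '' (S.patchR β [i] 0 ∪ S.patchL α [i + 1] 0)

/-- An admissible family for the simple decomposition of `E` by the `A i`. -/
def GoodFam (E : Set ℝ) {k : ℕ} (A : Fin k → Set ℝ) (𝒮 : Finset (Set ℝ)) : Prop :=
  (∀ B ∈ 𝒮, IsCompact B ∧ B ⊆ E) ∧ (⋃ B ∈ 𝒮, B) = E ∧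
  (∀ B ∈ 𝒮, ∀ B' ∈ 𝒮, B ≠ B' → CH B ∩ CH B' = ∅) ∧ (∀ i, A i ∈ 𝒮)


/-! ### Part 1: the matching principle -/

/-- A pair of similarities of the line with a common ratio. -/
structure SimP where
  r : ℝ
  b : ℝ
  d : ℝ

namespace SimP

def fT (s : SimP) (x : ℝ) : ℝ := s.r * x + s.b
def fD (s : SimP) (x : ℝ) : ℝ := s.r * x + s.d
def mul (s s' : SimP) : SimP := ⟨s.r * s'.r, s.r * s'.b + s.b, s.r * s'.d + s.d⟩

lemma continuous_fT (s : SimP) : Continuous s.fT := by unfold fT; fun_prop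
lemma continuous_fD (s : SimP) : Continuous s.fD := by unfold fD; fun_prop
lemma inj_fT (s : SimP) (h : 0 < s.r) : Function.Injective s.fT := by
  intro x y hxy
  have : s.r * x = s.r * y := by simpa [fT] using hxy
  exact mul_left_cancel₀ h.ne' this
lemma inj_fD (s : SimP) (h : 0 < s.r) : Function.Injective s.fD := by
  intro x y hxy
  have : s.r * x = s.r * y := by simpa [fD] using hxy
  exact mul_left_cancel₀ h.ne' this
lemma dist_fT (s : SimP) (h : 0 < s.r) (x y : ℝ) : dist (s.fT x) (s.fT y) = s.r * dist x y := by
  simp only [fT, Real.dist_eq]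
  rw [show s.r * x + s.b - (s.r * y + s.b) = s.r * (x - y) by ring, abs_mul, abs_of_pos h]
lemma dist_fD (s : SimP) (h : 0 < s.r) (x y : ℝ) : dist (s.fD x) (s.fD y) = s.r * dist x y := by
  simp only [fD, Real.dist_eq]
  rw [show s.r * x + s.d - (s.r * y + s.d) = s.r * (x - y) by ring, abs_mul, abs_of_pos h]
lemma mul_fT (s s' : SimP) (x : ℝ) : (s.mul s').fT x = s.fT (s'.fT x) := by
  simp only [mul, fT]; ring
lemma mul_fD (s s' : SimP) (x : ℝ) : (s.mul s').fD x = s.fD (s'.fD x) := by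
  simp only [mul, fD]; ring
lemma mul_fT_image (s s' : SimP) (X : Set ℝ) : (s.mul s').fT '' X = s.fT '' (s'.fT '' X) := by
  rw [Set.image_image]; exact Set.image_congr fun x _ => mul_fT s s' x
lemma mul_fD_image (s s' : SimP) (X : Set ℝ) : (s.mul s').fD '' X = s.fD '' (s'.fD '' X) := by
  rw [Set.image_image]; exact Set.image_congr fun x _ => mul_fD s s' x

end SimP

section Matching

variable {V : Type} {E : V → Type} (s : ∀ v, E v → SimP) (tgt : ∀ v, E v → V)
  (X Y : V → Set ℝ)

/-- Finite-level matching relation. -/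
def mrel : ℕ → V → ℝ → ℝ → Prop
  | 0, v, x, y => x ∈ X v ∧ y ∈ Y v
  | k + 1, v, x, y => ∃ e : E v, ∃ x1 y1, mrel k (tgt v e) x1 y1 ∧
      x = (s v e).fT x1 ∧ y = (s v e).fD y1

theorem matching_core [Finite V] [∀ v, Finite (E v)]
    (hr : ∀ v e, 0 < (s v e).r ∧ (s v e).r < 1)
    (hXc : ∀ v, IsCompact (X v)) (hYc : ∀ v, IsCompact (Y v))
    (hne : ∀ v, (X v).Nonempty ↔ (Y v).Nonempty)
    (hX : ∀ v, X v = ⋃ e, (s v e).fT '' X (tgt v e))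
    (hY : ∀ v, Y v = ⋃ e, (s v e).fD '' Y (tgt v e))
    (hXd : ∀ v, Pairwise fun e e' => Disjoint ((s v e).fT '' X (tgt v e)) ((s v e').fT '' X (tgt v e')))
    (hYd : ∀ v, Pairwise fun e e' => Disjoint ((s v e).fD '' Y (tgt v e)) ((s v e').fD '' Y (tgt v e')))
    (v : V) : LipEquivOn (Y v) (X v) := by
  classical
  obtain ⟨C, hC1, hCX, hCY⟩ : ∃ C : ℝ, 0 < C ∧ (∀ v, ∀ x ∈ X v, ∀ x' ∈ X v, dist x x' ≤ C) ∧
      (∀ v, ∀ x ∈ Y v, ∀ x' ∈ Y v, dist x x' ≤ C) := by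
    have h1 : ∀ᶠ C : ℝ in Filter.atTop, ∀ v, ∀ x ∈ X v, ∀ x' ∈ X v, dist x x' ≤ C := by
      rw [Filter.eventually_all]
      intro v
      filter_upwards [Filter.eventually_ge_atTop (Metric.diam (X v))] with C hC x hx x' hx'
      exact (Metric.dist_le_diam_of_mem (hXc v).isBounded hx hx').trans hC
    have h2 : ∀ᶠ C : ℝ in Filter.atTop, ∀ v, ∀ x ∈ Y v, ∀ x' ∈ Y v, dist x x' ≤ C := by
      rw [Filter.eventually_all]
      intro v
      filter_upwards [Filter.eventually_ge_atTop (Metric.diam (Y v))] with C hC x hx x' hx'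
      exact (Metric.dist_le_diam_of_mem (hYc v).isBounded hx hx').trans hC
    obtain ⟨C, a, b, c⟩ := ((Filter.eventually_gt_atTop (0 : ℝ)).and (h1.and h2)).exists
    exact ⟨C, a, b, c⟩
  have gap : ∀ A B : Set ℝ, IsCompact A → IsCompact B → Disjoint A B →
      ∀ᶠ δ : ℝ in nhdsWithin 0 (Set.Ioi 0), ∀ x ∈ A, ∀ y ∈ B, δ ≤ dist x y := by
    intro A B hA hB hAB
    obtain ⟨r, hr0, hr⟩ := Metric.exists_pos_forall_lt_edist hA hB.isClosed hAB
    have : (0 : ℝ) < r := by exact_mod_cast hr0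
    filter_upwards [Ioo_mem_nhdsGT this] with δ hδ x hx y hy
    have h := hr x hx y hy
    rw [edist_nndist] at h
    have h' : r < nndist x y := by exact_mod_cast h
    have h'' : (r : ℝ) < dist x y := by exact_mod_cast h'
    linarith [hδ.2]
  obtain ⟨δ, hδ, hδX, hδY⟩ : ∃ δ : ℝ, 0 < δ ∧
      (∀ v, ∀ e e' : E v, e ≠ e' → ∀ x ∈ (s v e).fT '' X (tgt v e),
        ∀ x' ∈ (s v e').fT '' X (tgt v e'), δ ≤ dist x x') ∧
      (∀ v, ∀ e e' : E v, e ≠ e' → ∀ x ∈ (s v e).fD '' Y (tgt v e),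
        ∀ x' ∈ (s v e').fD '' Y (tgt v e'), δ ≤ dist x x') := by
    have h1 : ∀ᶠ δ : ℝ in nhdsWithin 0 (Set.Ioi 0), ∀ v, ∀ e e' : E v, e ≠ e' →
        ∀ x ∈ (s v e).fT '' X (tgt v e), ∀ x' ∈ (s v e').fT '' X (tgt v e'), δ ≤ dist x x' := by
      rw [Filter.eventually_all]; intro v
      rw [Filter.eventually_all]; intro e
      rw [Filter.eventually_all]; intro e'
      by_cases h : e = e'
      · simp [h]
      filter_upwards [gap _ _ ((hXc _).image (s v e).continuous_fT)
        ((hXc _).image (s v e').continuous_fT) (hXd v h)] with δ hδ _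
      exact hδ
    have h2 : ∀ᶠ δ : ℝ in nhdsWithin 0 (Set.Ioi 0), ∀ v, ∀ e e' : E v, e ≠ e' →
        ∀ x ∈ (s v e).fD '' Y (tgt v e), ∀ x' ∈ (s v e').fD '' Y (tgt v e'), δ ≤ dist x x' := by
      rw [Filter.eventually_all]; intro v
      rw [Filter.eventually_all]; intro e
      rw [Filter.eventually_all]; intro e'
      by_cases h : e = e'
      · simp [h]
      filter_upwards [gap _ _ ((hYc _).image (s v e).continuous_fD)
        ((hYc _).image (s v e').continuous_fD) (hYd v h)] with δ hδ _
      exact hδ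
    have h0 : ∀ᶠ δ : ℝ in nhdsWithin 0 (Set.Ioi 0), 0 < δ := by
      filter_upwards [self_mem_nhdsWithin] with δ hδ using hδ
    obtain ⟨δ, a, b, c⟩ := (h0.and (h1.and h2)).exists
    exact ⟨δ, a, b, c⟩
  obtain ⟨l, hl0, hl1, hl⟩ : ∃ l : ℝ, 0 < l ∧ l < 1 ∧ ∀ v, ∀ e : E v, (s v e).r ≤ l := by
    have h1 : ∀ᶠ l : ℝ in nhdsWithin 1 (Set.Iio 1), ∀ v, ∀ e : E v, (s v e).r ≤ l := by
      rw [Filter.eventually_all]; intro v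
      rw [Filter.eventually_all]; intro e
      filter_upwards [Ioo_mem_nhdsLT (hr v e).2] with l hl using hl.1.le
    have h2 : ∀ᶠ l : ℝ in nhdsWithin 1 (Set.Iio 1), 0 < l ∧ l < 1 := by
      filter_upwards [Ioo_mem_nhdsLT (zero_lt_one' ℝ)] with l hl using hl
    obtain ⟨l, a, b⟩ := (h2.and h1).exists
    exact ⟨l, a.1, a.2, b⟩
  set R := mrel s tgt X Y with hR
  have hmem : ∀ k v x y, R k v x y → x ∈ X v ∧ y ∈ Y v := by
    intro k
    induction k with
    | zero => intro v x y h; exact h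
    | succ k ih =>
      rintro v x y ⟨e, x1, y1, h, rfl, rfl⟩
      obtain ⟨hx, hy⟩ := ih _ _ _ h
      rw [hX v, hY v]
      exact ⟨Set.mem_iUnion.2 ⟨e, x1, hx, rfl⟩, Set.mem_iUnion.2 ⟨e, y1, hy, rfl⟩⟩
  have hanti : ∀ k v x y, R (k + 1) v x y → R k v x y := by
    intro k
    induction k with
    | zero => intro v x y h; exact hmem _ _ _ _ h
    | succ k ih =>
      rintro v x y ⟨e, x1, y1, h, rfl, rfl⟩
      exact ⟨e, x1, y1, ih _ _ _ h, rfl, rfl⟩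
  have hest : ∀ k v x y x' y', R k v x y → R k v x' y' →
      dist x x' ≤ C / δ * dist y y' + l ^ k * C ∧ dist y y' ≤ C / δ * dist x x' + l ^ k * C := by
    have hCd : 0 < C / δ := div_pos hC1 hδ
    intro k
    induction k with
    | zero =>
      intro v x y x' y' h h'
      have a := hCX v x h.1 x' h'.1
      have b := hCY v y h.2 y' h'.2
      have := mul_nonneg hCd.le (dist_nonneg (x := x) (y := x'))
      have := mul_nonneg hCd.le (dist_nonneg (x := y) (y := y'))
      constructor <;> simp only [pow_zero, one_mul] <;> linarith
    | succ k ih =>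
      rintro v x y x' y' ⟨e, x1, y1, h, hx, hy⟩ ⟨e', x1', y1', h', hx', hy'⟩
      by_cases hee : e = e'
      · subst hee
        obtain ⟨i1, i2⟩ := ih _ _ _ _ _ h h'
        obtain ⟨r0, r1⟩ := hr v e
        have hrl := hl v e
        have hp : 0 ≤ l ^ k * C := by positivity
        have hq : (s v e).r * (l ^ k * C) ≤ l * (l ^ k * C) := mul_le_mul_of_nonneg_right hrl hp
        rw [hx, hx', hy, hy', SimP.dist_fT _ r0, SimP.dist_fD _ r0]
        have j1 := mul_le_mul_of_nonneg_left i1 r0.le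
        have j2 := mul_le_mul_of_nonneg_left i2 r0.le
        constructor
        · calc _ ≤ _ := j1
            _ = C / δ * ((s v e).r * dist y1 y1') + (s v e).r * (l ^ k * C) := by ring
            _ ≤ _ := by rw [pow_succ]; linarith
        · calc _ ≤ _ := j2
            _ = C / δ * ((s v e).r * dist x1 x1') + (s v e).r * (l ^ k * C) := by ring
            _ ≤ _ := by rw [pow_succ]; linarith
      · have m := hmem _ _ _ _ h
        have m' := hmem _ _ _ _ h'
        have gx : δ ≤ dist x x' := hδX v e e' hee _ ⟨x1, m.1, hx.symm⟩ _ ⟨x1', m'.1, hx'.symm⟩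
        have gy : δ ≤ dist y y' := hδY v e e' hee _ ⟨y1, m.2, hy.symm⟩ _ ⟨y1', m'.2, hy'.symm⟩
        have M := hmem (k + 1) v x y ⟨e, x1, y1, h, hx, hy⟩
        have M' := hmem (k + 1) v x' y' ⟨e', x1', y1', h', hx', hy'⟩
        have a := hCX v x M.1 x' M'.1
        have b := hCY v y M.2 y' M'.2
        have hp : 0 ≤ l ^ (k + 1) * C := by positivity
        have e1 : C / δ * δ = C := by field_simp
        have e2 := mul_le_mul_of_nonneg_left gx hCd.le
        have e3 := mul_le_mul_of_nonneg_left gy hCd.le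
        constructor <;> linarith
  have hcomp : ∀ k v, IsCompact {p : ℝ × ℝ | R k v p.1 p.2} := by
    intro k
    induction k with
    | zero => intro v; exact (hXc v).prod (hYc v)
    | succ k ih =>
      intro v
      have : {p : ℝ × ℝ | R (k + 1) v p.1 p.2} =
          ⋃ e : E v, (Prod.map (s v e).fT (s v e).fD) '' {p : ℝ × ℝ | R k (tgt v e) p.1 p.2} := by
        ext ⟨x, y⟩
        simp only [Set.mem_ofPred_eq, Set.mem_iUnion, Set.mem_image, Prod.exists, Prod.map_apply,
          Prod.mk.injEq]
        constructor
        · rintro ⟨e, x1, y1, h, hx, hy⟩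
          exact ⟨e, x1, y1, h, hx.symm, hy.symm⟩
        · rintro ⟨e, x1, y1, h, hx, hy⟩
          exact ⟨e, x1, y1, h, hx.symm, hy.symm⟩
      rw [this]
      exact isCompact_iUnion fun e =>
        (ih _).image ((s v e).continuous_fT.prodMap (s v e).continuous_fD)
  have hexY : ∀ k v, ∀ x ∈ X v, ∃ y, R k v x y := by
    intro k
    induction k with
    | zero =>
      intro v x hx
      obtain ⟨y, hy⟩ := (hne v).1 ⟨x, hx⟩
      exact ⟨y, hx, hy⟩
    | succ k ih =>
      intro v x hx
      rw [hX v] at hx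
      obtain ⟨e, x1, hx1, rfl⟩ := Set.mem_iUnion.1 hx
      obtain ⟨y, hy⟩ := ih _ x1 hx1
      exact ⟨_, e, x1, y, hy, rfl, rfl⟩
  have hexX : ∀ k v, ∀ y ∈ Y v, ∃ x, R k v x y := by
    intro k
    induction k with
    | zero =>
      intro v x hx
      obtain ⟨y, hy⟩ := (hne v).2 ⟨x, hx⟩
      exact ⟨y, hy, hx⟩
    | succ k ih =>
      intro v x hx
      rw [hY v] at hx
      obtain ⟨e, x1, hx1, rfl⟩ := Set.mem_iUnion.1 hx
      obtain ⟨y, hy⟩ := ih _ x1 hx1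
      exact ⟨_, e, y, x1, hy, rfl, rfl⟩
  have hallY : ∀ x ∈ X v, ∃ y, ∀ k, R k v x y := by
    intro x hx
    have hcl : ∀ k, IsClosed {y | R k v x y} := fun k =>
      (hcomp k v).isClosed.preimage (f := fun y => (x, y)) (by fun_prop)
    obtain ⟨y, hy⟩ := IsCompact.nonempty_iInter_of_sequence_nonempty_isCompact_isClosed
      (fun k => {y | R k v x y}) (fun k y hy => hanti k v x y hy) (fun k => hexY k v x hx)
      ((hYc v).of_isClosed_subset (hcl 0) fun y hy => hy.2) hcl
    exact ⟨y, fun k => Set.mem_iInter.1 hy k⟩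
  have hallX : ∀ y ∈ Y v, ∃ x, ∀ k, R k v x y := by
    intro x hx
    have hcl : ∀ k, IsClosed {y | R k v y x} := fun k =>
      (hcomp k v).isClosed.preimage (f := fun y => (y, x)) (by fun_prop)
    obtain ⟨y, hy⟩ := IsCompact.nonempty_iInter_of_sequence_nonempty_isCompact_isClosed
      (fun k => {y | R k v y x}) (fun k y hy => hanti k v y x hy) (fun k => hexX k v x hx)
      ((hXc v).of_isClosed_subset (hcl 0) fun y hy => hy.1) hcl
    exact ⟨y, fun k => Set.mem_iInter.1 hy k⟩
  have hfin : ∀ x y x' y', (∀ k, R k v x y) → (∀ k, R k v x' y') →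
      dist x x' ≤ C / δ * dist y y' ∧ dist y y' ≤ C / δ * dist x x' := by
    intro x y x' y' h h'
    have lim : ∀ a : ℝ, Filter.Tendsto (fun k : ℕ => a + l ^ k * C) Filter.atTop (nhds a) := by
      intro a
      simpa using ((tendsto_pow_atTop_nhds_zero_of_lt_one hl0.le hl1).mul_const C).const_add a
    exact ⟨ge_of_tendsto' (lim _) fun k => (hest k v x y x' y' (h k) (h' k)).1,
      ge_of_tendsto' (lim _) fun k => (hest k v x y x' y' (h k) (h' k)).2⟩
  choose! f hf using hallX
  have hCd : 0 < C / δ := div_pos hC1 hδ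
  have hCd' : 0 < δ / C := div_pos hδ hC1
  have hlow : ∀ x ∈ Y v, ∀ y ∈ Y v, δ / C * dist x y ≤ dist (f x) (f y) := by
    intro x hx y hy
    have := (hfin _ _ _ _ (hf x hx) (hf y hy)).2
    calc δ / C * dist x y ≤ δ / C * (C / δ * dist (f x) (f y)) :=
          mul_le_mul_of_nonneg_left this hCd'.le
      _ = dist (f x) (f y) := by field_simp
  refine ⟨f, min (δ / C) (C / δ), C / δ, lt_min hCd' hCd, min_le_right _ _, ⟨?_, ?_, ?_⟩, ?_⟩
  · intro y hy
    exact (hmem _ _ _ _ (hf y hy 0)).1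
  · intro x hx y hy hxy
    have := hlow x hx y hy
    rw [hxy, dist_self] at this
    have h2 : dist x y ≤ 0 := by
      by_contra hcon
      push Not at hcon
      have := mul_pos hCd' hcon
      linarith
    exact dist_le_zero.1 h2
  · intro x hx
    obtain ⟨y, hy⟩ := hallY x hx
    have hyY := (hmem _ _ _ _ (hy 0)).2
    refine ⟨y, hyY, ?_⟩
    have := (hfin _ _ _ _ (hf y hyY) hy).1
    rw [dist_self, mul_zero] at this
    exact dist_le_zero.1 this
  · intro x hx y hy
    refine ⟨?_, (hfin _ _ _ _ (hf x hx) (hf y hy)).1⟩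
    exact (mul_le_mul_of_nonneg_right (min_le_left _ _) dist_nonneg).trans (hlow x hx y hy)

end Matching

/-- Strictly contracting dust-like decomposition of the pair `(X, Y)` into copies of pairs in `𝓑`. -/
def DecLt (𝓑 : Set (Set ℝ × Set ℝ)) (X Y : Set ℝ) : Prop :=
  ∃ (ι : Type) (_ : Finite ι) (s : ι → SimP) (P : ι → Set ℝ × Set ℝ),
    (∀ i, P i ∈ 𝓑 ∧ 0 < (s i).r ∧ (s i).r < 1) ∧
    X = (⋃ i, (s i).fT '' (P i).1) ∧ Y = (⋃ i, (s i).fD '' (P i).2) ∧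
    (Pairwise fun i j => Disjoint ((s i).fT '' (P i).1) ((s j).fT '' (P j).1)) ∧
    (Pairwise fun i j => Disjoint ((s i).fD '' (P i).2) ((s j).fD '' (P j).2))

theorem matching (𝓑 : Set (Set ℝ × Set ℝ)) (hfin : 𝓑.Finite)
    (hK : ∀ p ∈ 𝓑, IsCompact p.1 ∧ IsCompact p.2 ∧ (p.1.Nonempty ↔ p.2.Nonempty))
    (hdec : ∀ p ∈ 𝓑, DecLt 𝓑 p.1 p.2) (p : Set ℝ × Set ℝ) (hp : p ∈ 𝓑) :
    LipEquivOn p.2 p.1 := by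
  have := hfin.to_subtype
  choose E hE s P h1 h2 h3 h4 h5 using fun v : 𝓑 => hdec v.1 v.2
  exact matching_core (V := 𝓑) (E := E) s (fun v e => ⟨P v e, (h1 v e).1⟩)
    (fun v => v.1.1) (fun v => v.1.2) (fun v e => (h1 v e).2) (fun v => (hK v.1 v.2).1)
    (fun v => (hK v.1 v.2).2.1) (fun v => (hK v.1 v.2).2.2) h2 h3 h4 h5 ⟨p, hp⟩

namespace DecLt

variable {𝓑 : Set (Set ℝ × Set ℝ)}

lemma empty : DecLt 𝓑 ∅ ∅ :=
  ⟨Empty, inferInstance, fun e => e.elim, fun e => e.elim, fun e => e.elim, by simp, by simp,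
    fun e => e.elim, fun e => e.elim⟩

lemma base {p : Set ℝ × Set ℝ} (hp : p ∈ 𝓑) (s : SimP) (h0 : 0 < s.r) (h1 : s.r < 1) :
    DecLt 𝓑 (s.fT '' p.1) (s.fD '' p.2) :=
  ⟨Unit, inferInstance, fun _ => s, fun _ => p, fun _ => ⟨hp, h0, h1⟩,
    (Set.iUnion_const _).symm, (Set.iUnion_const _).symm,
    fun a b h => (h rfl).elim, fun a b h => (h rfl).elim⟩

lemma union {X Y X' Y' : Set ℝ} (h : DecLt 𝓑 X Y) (h' : DecLt 𝓑 X' Y') (hX : Disjoint X X')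
    (hY : Disjoint Y Y') : DecLt 𝓑 (X ∪ X') (Y ∪ Y') := by
  obtain ⟨ι, _, s, P, a, rfl, rfl, d, e⟩ := h
  obtain ⟨ι', _, s', P', a', rfl, rfl, d', e'⟩ := h'
  simp only [Set.disjoint_iUnion_left, Set.disjoint_iUnion_right] at hX hY
  refine ⟨ι ⊕ ι', inferInstance, Sum.elim s s', Sum.elim P P', ?_, ?_, ?_, ?_, ?_⟩
  · rintro (i | i)
    · exact a i
    · exact a' i
  · simp [Set.iUnion_sum]
  · simp [Set.iUnion_sum]
  · rintro (i | i) (j | j) hij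
    · exact d fun hh => hij (by rw [hh])
    · exact hX j i
    · exact (hX i j).symm
    · exact d' fun hh => hij (by rw [hh])
  · rintro (i | i) (j | j) hij
    · exact e fun hh => hij (by rw [hh])
    · exact hY j i
    · exact (hY i j).symm
    · exact e' fun hh => hij (by rw [hh])

lemma scale {X Y : Set ℝ} (h : DecLt 𝓑 X Y) (t : SimP) (h0 : 0 < t.r) (h1 : t.r ≤ 1) :
    DecLt 𝓑 (t.fT '' X) (t.fD '' Y) := by
  obtain ⟨ι, _, s, P, a, rfl, rfl, d, e⟩ := h
  refine ⟨ι, inferInstance, fun i => t.mul (s i), P, ?_, ?_, ?_, ?_, ?_⟩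
  · intro i
    obtain ⟨a1, a2, a3⟩ := a i
    exact ⟨a1, mul_pos h0 a2, mul_lt_one_of_nonneg_of_lt_one_right h1 a2.le a3⟩
  · simp only [Set.image_iUnion, SimP.mul_fT_image]
  · simp only [Set.image_iUnion, SimP.mul_fD_image]
  · intro i j hij
    simp only [SimP.mul_fT_image]
    exact (Set.disjoint_image_iff (t.inj_fT h0)).2 (d hij)
  · intro i j hij
    simp only [SimP.mul_fD_image]
    exact (Set.disjoint_image_iff (t.inj_fD h0)).2 (e hij)

end DecLt

/-! ### Part 2: the symbolic system -/

namespace SimP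

def pow (s : SimP) : ℕ → SimP
  | 0 => ⟨1, 0, 0⟩
  | m + 1 => s.mul (pow s m)

lemma pow_r (s : SimP) (m : ℕ) : (s.pow m).r = s.r ^ m := by
  induction m with
  | zero => simp [pow]
  | succ m ih => rw [pow, mul, ih, pow_succ]; ring

lemma pow_zero_fT (s : SimP) (X : Set ℝ) : (s.pow 0).fT '' X = X := by
  have : (s.pow 0).fT = id := by funext x; simp [pow, fT]
  rw [this, Set.image_id]

lemma pow_zero_fD (s : SimP) (X : Set ℝ) : (s.pow 0).fD '' X = X := by
  have : (s.pow 0).fD = id := by funext x; simp [pow, fD]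
  rw [this, Set.image_id]

lemma pow_succ_fT (s : SimP) (m : ℕ) (X : Set ℝ) :
    (s.pow (m + 1)).fT '' X = s.fT '' ((s.pow m).fT '' X) := mul_fT_image _ _ _

lemma pow_succ_fD (s : SimP) (m : ℕ) (X : Set ℝ) :
    (s.pow (m + 1)).fD '' X = s.fD '' ((s.pow m).fD '' X) := mul_fD_image _ _ _

lemma pow_add_fT (s : SimP) (a b : ℕ) (X : Set ℝ) :
    (s.pow (a + b)).fT '' X = (s.pow a).fT '' ((s.pow b).fT '' X) := by
  induction a with
  | zero => rw [Nat.zero_add, pow_zero_fT]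
  | succ a ih => rw [Nat.succ_add, pow_succ_fT, pow_succ_fT, ih]

lemma pow_add_fD (s : SimP) (a b : ℕ) (X : Set ℝ) :
    (s.pow (a + b)).fD '' X = (s.pow a).fD '' ((s.pow b).fD '' X) := by
  induction a with
  | zero => rw [Nat.zero_add, pow_zero_fD]
  | succ a ih => rw [Nat.succ_add, pow_succ_fD, pow_succ_fD, ih]

lemma pow_fix (s : SimP) (z : ℝ) (h : s.fT z = z) (m : ℕ) : (s.pow m).fT z = z := by
  induction m with
  | zero => simp [pow, fT]
  | succ m ih => rw [pow, mul_fT, ih, h]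

end SimP

/-- Abstract touching system together with its dust-like companion. -/
structure Sys (n : ℕ) where
  s : ℕ → SimP
  T : Set ℝ
  D : Set ℝ
  θ : ℝ → ℝ
  touch : ℕ → Prop
  npos : 2 ≤ n
  rpos : ∀ c, c < n → 0 < (s c).r
  rlt : ∀ c, c < n → (s c).r < 1
  cT : IsCompact T
  cD : IsCompact D
  neD : D.Nonempty
  invT : ∀ x, x ∈ T ↔ ∃ c, c < n ∧ ∃ y ∈ T, (s c).fT y = x
  invD : ∀ x, x ∈ D ↔ ∃ c, c < n ∧ ∃ y ∈ D, (s c).fD y = x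
  θT : ∀ y ∈ D, θ y ∈ T
  θeq : ∀ c, c < n → ∀ y ∈ D, θ ((s c).fD y) = (s c).fT (θ y)
  dD : ∀ c, c < n → ∀ c', c' < n → ∀ x ∈ D, ∀ y ∈ D, (s c).fD x = (s c').fD y → c = c'
  zT : (0 : ℝ) ∈ T
  oT : (1 : ℝ) ∈ T
  sep : ∀ j c, j < c → c < n → ∀ y ∈ T, ∀ x ∈ T, (s j).fT y = (s c).fT x →
    c = j + 1 ∧ touch j ∧ y = 1 ∧ x = 0
  tch : ∀ j, touch j → j + 1 < n ∧ (s j).fT 1 = (s (j + 1)).fT 0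
  fix0 : (s 0).fT 0 = 0
  fix1 : (s (n - 1)).fT 1 = 1

namespace Sys

variable {n : ℕ} (Z : Sys n)

def tau (X : Set ℝ) : Set ℝ := {y | y ∈ Z.D ∧ Z.θ y ∈ X}

lemma mapT {c : ℕ} (hc : c < n) {x : ℝ} (hx : x ∈ Z.T) : (Z.s c).fT x ∈ Z.T :=
  (Z.invT _).2 ⟨c, hc, x, hx, rfl⟩

lemma mapD {c : ℕ} (hc : c < n) {x : ℝ} (hx : x ∈ Z.D) : (Z.s c).fD x ∈ Z.D :=
  (Z.invD _).2 ⟨c, hc, x, hx, rfl⟩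

lemma tau_T : Z.tau Z.T = Z.D := by
  ext y; exact ⟨fun h => h.1, fun h => ⟨h, Z.θT y h⟩⟩

lemma tau_union (X X' : Set ℝ) : Z.tau (X ∪ X') = Z.tau X ∪ Z.tau X' := by
  ext y; simp only [tau, Set.mem_ofPred_eq, Set.mem_union]; tauto

lemma tau_diff (X X' : Set ℝ) : Z.tau (X \ X') = Z.tau X \ Z.tau X' := by
  ext y; simp only [tau, Set.mem_ofPred_eq, Set.mem_sdiff]; tauto

lemma tau_empty : Z.tau ∅ = ∅ := by
  ext y; simp [tau]

lemma tau_disj {X X' : Set ℝ} (h : Disjoint X X') : Disjoint (Z.tau X) (Z.tau X') := by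
  rw [Set.disjoint_left] at h ⊢
  intro y hy hy'
  exact h hy.2 hy'.2

lemma tau_mono {X X' : Set ℝ} (h : X ⊆ X') : Z.tau X ⊆ Z.tau X' := fun _ hy => ⟨hy.1, h hy.2⟩

lemma tau_congr {X X' : Set ℝ} (h : ∀ x ∈ Z.T, (x ∈ X ↔ x ∈ X')) : Z.tau X = Z.tau X' := by
  ext y
  constructor
  · rintro ⟨h1, h2⟩; exact ⟨h1, (h _ (Z.θT y h1)).1 h2⟩
  · rintro ⟨h1, h2⟩; exact ⟨h1, (h _ (Z.θT y h1)).2 h2⟩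

lemma mem_tau_iff (X : Set ℝ) (y : ℝ) :
    y ∈ Z.tau X ↔ ∃ c, c < n ∧ ∃ y' ∈ Z.tau ((Z.s c).fT ⁻¹' X), (Z.s c).fD y' = y := by
  constructor
  · rintro ⟨h1, h2⟩
    obtain ⟨c, hc, y', hy', rfl⟩ := (Z.invD y).1 h1
    refine ⟨c, hc, y', ⟨hy', ?_⟩, rfl⟩
    rw [Z.θeq c hc y' hy'] at h2
    exact h2
  · rintro ⟨c, hc, y', ⟨hy', h2⟩, rfl⟩
    refine ⟨Z.mapD hc hy', ?_⟩
    rw [Z.θeq c hc y' hy']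
    exact h2

/-- `X` (within `T`) is a union of cylinders of level `N`. -/
def Lev : ℕ → Set ℝ → Prop
  | 0, X => Z.T ⊆ X ∨ Disjoint Z.T X
  | N + 1, X => ∀ c, c < n → Lev N ((Z.s c).fT ⁻¹' X)

variable {Z}

lemma Lev.congr {N : ℕ} : ∀ {X X' : Set ℝ}, Z.Lev N X → (∀ x ∈ Z.T, (x ∈ X ↔ x ∈ X')) → Z.Lev N X' := by
  induction N with
  | zero =>
    intro X X' h hX
    rcases h with h | h
    · exact Or.inl fun x hx => (hX x hx).1 (h hx)
    · right
      rw [Set.disjoint_left] at h ⊢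
      intro x hx hx'
      exact h hx ((hX x hx).2 hx')
  | succ N ih =>
    intro X X' h hX c hc
    exact ih (h c hc) fun x hx => hX _ (Z.mapT hc hx)

lemma Lev.succ {N : ℕ} : ∀ {X : Set ℝ}, Z.Lev N X → Z.Lev (N + 1) X := by
  induction N with
  | zero =>
    intro X h c hc
    rcases h with h | h
    · exact Or.inl fun x hx => h (Z.mapT hc hx)
    · right
      rw [Set.disjoint_left] at h ⊢
      intro x hx hx'
      exact h (Z.mapT hc hx) hx'
  | succ N ih =>
    intro X h c hc
    exact ih (h c hc)

lemma Lev.mono {N M : ℕ} {X : Set ℝ} (h : Z.Lev N X) (hNM : N ≤ M) : Z.Lev M X := by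
  induction hNM with
  | refl => exact h
  | step _ ih => exact ih.succ

lemma Lev.compl {N : ℕ} : ∀ {X : Set ℝ}, Z.Lev N X → Z.Lev N Xᶜ := by
  induction N with
  | zero =>
    intro X h
    rcases h with h | h
    · right
      rw [Set.disjoint_left]
      intro x hx hx'
      exact hx' (h hx)
    · left
      rw [Set.disjoint_left] at h
      exact fun x hx => h hx
  | succ N ih =>
    intro X h c hc
    exact ih (h c hc)

lemma Lev.union {N : ℕ} : ∀ {X X' : Set ℝ}, Z.Lev N X → Z.Lev N X' → Z.Lev N (X ∪ X') := by
  induction N with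
  | zero =>
    intro X X' h h'
    rcases h with h | h
    · exact Or.inl fun x hx => Or.inl (h hx)
    rcases h' with h' | h'
    · exact Or.inl fun x hx => Or.inr (h' hx)
    · exact Or.inr (Set.disjoint_union_right.2 ⟨h, h'⟩)
  | succ N ih =>
    intro X X' h h' c hc
    exact ih (h c hc) (h' c hc)

lemma Lev.diff {N : ℕ} {X X' : Set ℝ} (h : Z.Lev N X) (h' : Z.Lev N X') : Z.Lev N (X \ X') := by
  have := (h.compl.union h').compl
  rwa [Set.compl_union, compl_compl] at this

lemma lev_T : Z.Lev 0 Z.T := Or.inl subset_rfl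

lemma lev_empty : Z.Lev 0 ∅ := Or.inr (by simp)

lemma Lev.eq_iUnion {X : Set ℝ} (hX : X ⊆ Z.T) :
    X = ⋃ c ∈ Finset.range n, (Z.s c).fT '' (((Z.s c).fT ⁻¹' X) ∩ Z.T) := by
  ext x
  simp only [Set.mem_iUnion, Finset.mem_range, exists_prop]
  constructor
  · intro hx
    obtain ⟨c, hc, y, hy, rfl⟩ := (Z.invT x).1 (hX hx)
    exact ⟨c, hc, y, ⟨hx, hy⟩, rfl⟩
  · rintro ⟨c, hc, y, ⟨hy, _⟩, rfl⟩
    exact hy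

lemma tau_inter (X : Set ℝ) : Z.tau (X ∩ Z.T) = Z.tau X :=
  Z.tau_congr fun x hx => ⟨fun h => h.1, fun h => ⟨h, hx⟩⟩

lemma tau_eq_iUnion (X : Set ℝ) :
    Z.tau X = ⋃ c ∈ Finset.range n, (Z.s c).fD '' Z.tau (((Z.s c).fT ⁻¹' X) ∩ Z.T) := by
  ext y
  simp only [Set.mem_iUnion, Finset.mem_range, exists_prop, tau_inter]
  exact Z.mem_tau_iff X y

lemma Lev.inter_T {N : ℕ} {X : Set ℝ} (h : Z.Lev N X) : Z.Lev N (X ∩ Z.T) :=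
  h.congr fun x hx => ⟨fun h => ⟨h, hx⟩, fun h => h.1⟩

lemma Lev.compact {N : ℕ} : ∀ {X : Set ℝ}, X ⊆ Z.T → Z.Lev N X → IsCompact X ∧ IsCompact (Z.tau X) ∧
    (X.Nonempty ↔ (Z.tau X).Nonempty) := by
  induction N with
  | zero =>
    intro X hX h
    rcases h with h | h
    · obtain rfl : X = Z.T := hX.antisymm h
      rw [Z.tau_T]
      exact ⟨Z.cT, Z.cD, fun _ => Z.neD, fun _ => ⟨0, Z.zT⟩⟩
    · obtain rfl : X = ∅ := by
        rw [Set.disjoint_left] at h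
        exact Set.eq_empty_of_forall_notMem fun x hx => h (hX hx) hx
      rw [Z.tau_empty]
      simp
  | succ N ih =>
    intro X hX h
    have key : ∀ c, c < n → _ := fun c hc => ih (X := ((Z.s c).fT ⁻¹' X) ∩ Z.T)
      Set.inter_subset_right (h c hc).inter_T
    refine ⟨?_, ?_, ?_, ?_⟩
    · rw [Lev.eq_iUnion hX]
      exact (Finset.range n).isCompact_biUnion fun c hc =>
        (key c (Finset.mem_range.1 hc)).1.image (Z.s c).continuous_fT
    · rw [tau_eq_iUnion X]
      exact (Finset.range n).isCompact_biUnion fun c hc =>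
        (key c (Finset.mem_range.1 hc)).2.1.image (Z.s c).continuous_fD
    · rintro ⟨x, hx⟩
      obtain ⟨c, hc, y, hy, rfl⟩ := (Z.invT x).1 (hX hx)
      obtain ⟨w, hw⟩ := (key c hc).2.2.1 ⟨y, hx, hy⟩
      rw [tau_inter] at hw
      exact ⟨_, (Z.mem_tau_iff X _).2 ⟨c, hc, w, hw, rfl⟩⟩
    · rintro ⟨y, hy⟩
      exact ⟨_, hy.2⟩

variable (Z) in
/-- The copy `Ψ_c(X)` is isolated from the other first level cylinders. -/
def Iso (c : ℕ) (X : Set ℝ) : Prop :=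
  X ⊆ Z.T ∧ ∀ c', c' < n → c' ≠ c → ∀ x ∈ Z.T, (Z.s c').fT x ∉ (Z.s c).fT '' X

lemma Iso.tau {c : ℕ} (hc : c < n) {X : Set ℝ} (h : Z.Iso c X) :
    Z.tau ((Z.s c).fT '' X) = (Z.s c).fD '' Z.tau X := by
  ext y
  rw [Z.mem_tau_iff]
  constructor
  · rintro ⟨c', hc', y', ⟨h1, h2⟩, rfl⟩
    by_cases hcc : c' = c
    · subst hcc
      rw [Set.mem_preimage, (SimP.inj_fT _ (Z.rpos _ hc)).mem_set_image] at h2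
      exact ⟨y', ⟨h1, h2⟩, rfl⟩
    · exact (h.2 c' hc' hcc _ (Z.θT _ h1) h2).elim
  · rintro ⟨y', ⟨h1, h2⟩, rfl⟩
    exact ⟨c, hc, y', ⟨h1, ⟨_, h2, rfl⟩⟩, rfl⟩

lemma Iso.lev {c : ℕ} (hc : c < n) {X : Set ℝ} (h : Z.Iso c X) {N : ℕ} (hX : Z.Lev N X) :
    Z.Lev (N + 1) ((Z.s c).fT '' X) := by
  intro c' hc'
  by_cases hcc : c' = c
  · subst hcc
    rwa [Set.preimage_image_eq _ (SimP.inj_fT _ (Z.rpos _ hc))]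
  · refine (lev_empty.mono (Nat.zero_le N)).congr fun x hx => ?_
    simp only [Set.mem_empty_iff_false, false_iff]
    exact h.2 c' hc' hcc x hx

lemma Iso.sub {c : ℕ} (hc : c < n) {X : Set ℝ} (h : Z.Iso c X) : (Z.s c).fT '' X ⊆ Z.T := by
  rintro _ ⟨x, hx, rfl⟩
  exact Z.mapT hc (h.1 hx)

variable (Z) in
/-- The `z`-end of the cylinder `a` is not touched. -/
def Free (z : ℝ) (a : ℕ) : Prop :=
  ∀ c, c < n → c ≠ a → ∀ x ∈ Z.T, ∀ y ∈ Z.T, (Z.s c).fT x = (Z.s a).fT y → y = 1 - z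

lemma Free.iso {z : ℝ} {a : ℕ} (h : Z.Free z a) {X : Set ℝ} (hX : X ⊆ Z.T) (hz : 1 - z ∉ X) :
    Z.Iso a X := by
  refine ⟨hX, ?_⟩
  rintro c hc hca x hx ⟨y, hy, hxy⟩
  have := h c hc hca x hx y (hX hy) hxy.symm
  exact hz (this ▸ hy)

variable (Z) in
/-- An end of the system: the end point, its letter, its first-level touching run. -/
structure EndD where
  z : ℝ
  e : ℕ
  R : Set ℝ
  zne : z ≠ 1 - z
  en : e < n
  hz : (Z.s e).fT z = z
  zT : z ∈ Z.T
  RT : R ⊆ Z.T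
  lev1 : Z.Lev 1 R
  zR : z ∈ R
  zR' : 1 - z ∉ R
  min : ∀ X, Z.Lev 1 X → z ∈ X → R ⊆ X
  eR : (Z.s e).fT '' Z.T ⊆ R
  free : Z.Free z e

namespace EndD

variable (P : Z.EndD)

def RR (m : ℕ) : Set ℝ := ((Z.s P.e).pow m).fT '' P.R

lemma RR_zero : P.RR 0 = P.R := SimP.pow_zero_fT _ _
lemma RR_succ (m : ℕ) : P.RR (m + 1) = (Z.s P.e).fT '' P.RR m := SimP.pow_succ_fT _ _ _

lemma RR_sub (m : ℕ) : P.RR m ⊆ P.R := by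
  induction m with
  | zero => rw [RR_zero]
  | succ m ih =>
    rw [RR_succ]
    exact (Set.image_mono (ih.trans P.RT)).trans P.eR

lemma RR_T (m : ℕ) : P.RR m ⊆ Z.T := (P.RR_sub m).trans P.RT

lemma z_RR (m : ℕ) : P.z ∈ P.RR m := ⟨P.z, P.zR, SimP.pow_fix _ _ P.hz m⟩

lemma z'_RR (m : ℕ) : 1 - P.z ∉ P.RR m := fun h => P.zR' (P.RR_sub m h)

lemma RR_iso (m : ℕ) : Z.Iso P.e (P.RR m) := P.free.iso (P.RR_T m) (P.z'_RR m)

lemma RR_lev (m : ℕ) : Z.Lev (m + 1) (P.RR m) := by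
  induction m with
  | zero => rw [RR_zero]; exact P.lev1
  | succ m ih => rw [RR_succ]; exact (P.RR_iso m).lev P.en ih

lemma RR_tau (m : ℕ) : Z.tau (P.RR m) = ((Z.s P.e).pow m).fD '' Z.tau P.R := by
  induction m with
  | zero => rw [RR_zero, SimP.pow_zero_fD]
  | succ m ih => rw [RR_succ, (P.RR_iso m).tau P.en, ih, SimP.pow_succ_fD]

lemma RR_min (m : ℕ) : ∀ X, Z.Lev (m + 1) X → P.z ∈ X → P.RR m ⊆ X := by
  induction m with
  | zero => rw [RR_zero]; exact P.min
  | succ m ih =>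
    intro X hX hz
    rw [RR_succ, Set.image_subset_iff]
    refine ih _ (hX P.e P.en) ?_
    rw [Set.mem_preimage, P.hz]; exact hz

lemma RR_anti {m m' : ℕ} (h : m ≤ m') : P.RR m' ⊆ P.RR m :=
  P.RR_min m' _ ((P.RR_lev m).mono (by omega)) (P.z_RR m)

end EndD

/-- The touching patch around the touching letter `j`. -/
def T2 (A B : Z.EndD) (j a b : ℕ) : Set ℝ :=
  (Z.s j).fT '' A.RR a ∪ (Z.s (j + 1)).fT '' B.RR b

section T2

variable (A B : Z.EndD)

lemma mem_T2 (hA : A.z = 1) (hB : B.z = 0) {j : ℕ} (hj : Z.touch j) (a b : ℕ) {c : ℕ} (hc : c < n) {x : ℝ} (hx : x ∈ Z.T) :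
    (Z.s c).fT x ∈ T2 A B j a b ↔ (c = j ∧ x ∈ A.RR a) ∨ (c = j + 1 ∧ x ∈ B.RR b) := by
  have hj1 := (Z.tch j hj).1
  have a0 := A.z'_RR a
  have b0 := B.z'_RR b
  rw [hA, sub_self] at a0
  rw [hB, sub_zero] at b0
  have a1 := A.z_RR a
  have b1 := B.z_RR b
  rw [hA] at a1
  rw [hB] at b1
  constructor
  · rintro (⟨y, hy, hxy⟩ | ⟨y, hy, hxy⟩)
    · rcases lt_trichotomy c j with h | h | h
      · have := Z.sep c j h (by omega) x hx y (A.RR_T a hy) hxy.symm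
        exact (a0 (this.2.2.2 ▸ hy)).elim
      · subst h
        exact Or.inl ⟨rfl, (SimP.inj_fT _ (Z.rpos _ hc) hxy) ▸ hy⟩
      · have := Z.sep j c h hc y (A.RR_T a hy) x hx hxy
        exact Or.inr ⟨this.1, this.2.2.2 ▸ b1⟩
    · rcases lt_trichotomy c (j + 1) with h | h | h
      · have := Z.sep c (j + 1) h (by omega) x hx y (B.RR_T b hy) hxy.symm
        exact Or.inl ⟨by omega, this.2.2.1 ▸ a1⟩
      · subst h
        exact Or.inr ⟨rfl, (SimP.inj_fT _ (Z.rpos _ hc) hxy) ▸ hy⟩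
      · have := Z.sep (j + 1) c h hc y (B.RR_T b hy) x hx hxy
        exact (b0 (this.2.2.1 ▸ hy)).elim
  · rintro (⟨rfl, h⟩ | ⟨rfl, h⟩)
    · exact Or.inl ⟨x, h, rfl⟩
    · exact Or.inr ⟨x, h, rfl⟩

lemma T2_sub {j : ℕ} (hj : Z.touch j) (a b : ℕ) : T2 A B j a b ⊆ Z.T := by
  have hj1 := (Z.tch j hj).1
  rintro _ (⟨y, hy, rfl⟩ | ⟨y, hy, rfl⟩)
  · exact Z.mapT (by omega) (A.RR_T a hy)
  · exact Z.mapT (by omega) (B.RR_T b hy)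

lemma T2_tau (hA : A.z = 1) (hB : B.z = 0) {j : ℕ} (hj : Z.touch j) (a b : ℕ) :
    Z.tau (T2 A B j a b) = (Z.s j).fD '' Z.tau (A.RR a) ∪ (Z.s (j + 1)).fD '' Z.tau (B.RR b) := by
  have hj1 := (Z.tch j hj).1
  ext y
  rw [Z.mem_tau_iff]
  constructor
  · rintro ⟨c, hc, y', ⟨h1, h2⟩, rfl⟩
    rcases (mem_T2 A B hA hB hj a b hc (Z.θT _ h1)).1 h2 with ⟨rfl, h⟩ | ⟨rfl, h⟩
    · exact Or.inl ⟨y', ⟨h1, h⟩, rfl⟩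
    · exact Or.inr ⟨y', ⟨h1, h⟩, rfl⟩
  · rintro (⟨y', ⟨h1, h2⟩, rfl⟩ | ⟨y', ⟨h1, h2⟩, rfl⟩)
    · exact ⟨j, by omega, y', ⟨h1, Or.inl ⟨_, h2, rfl⟩⟩, rfl⟩
    · exact ⟨j + 1, by omega, y', ⟨h1, Or.inr ⟨_, h2, rfl⟩⟩, rfl⟩

lemma T2_lev (hA : A.z = 1) (hB : B.z = 0) {j : ℕ} (hj : Z.touch j) (M : ℕ) : Z.Lev (M + 2) (T2 A B j M M) := by
  intro c hc
  by_cases h1 : c = j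
  · refine (A.RR_lev M).congr fun x hx => ?_
    rw [Set.mem_preimage, mem_T2 A B hA hB hj M M hc hx]
    simp [h1]
  by_cases h2 : c = j + 1
  · refine (B.RR_lev M).congr fun x hx => ?_
    rw [Set.mem_preimage, mem_T2 A B hA hB hj M M hc hx]
    simp [h2]
  · refine (lev_empty.mono (Nat.zero_le _)).congr fun x hx => ?_
    rw [Set.mem_preimage, mem_T2 A B hA hB hj M M hc hx]
    simp [h1, h2]

lemma peel (hA : A.z = 1) (hB : B.z = 0) (G : Set ℝ → Set ℝ → Prop) (G0 : G ∅ ∅)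
    (Gu : ∀ X Y X' Y', G X Y → G X' Y' → Disjoint X X' → Disjoint Y Y' → G (X ∪ X') (Y ∪ Y'))
    (M : ℕ) (h2 : ∀ j, Z.touch j → G (T2 A B j M M) (Z.tau (T2 A B j M M)))
    (h1 : ∀ c, c < n → ∀ X, X ⊆ Z.T → Z.Lev (M + 1) X → G ((Z.s c).fT '' X) ((Z.s c).fD '' Z.tau X)) :
    ∀ X, X ⊆ Z.T → Z.Lev (M + 2) X → G X (Z.tau X) := by
  classical
  have main : ∀ k : ℕ, ∀ X, X ⊆ Z.T → Z.Lev (M + 2) X →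
      ((Finset.range n).filter fun j => Z.touch j ∧ (Z.s j).fT 1 ∈ X).card ≤ k → G X (Z.tau X) := by
    intro k
    induction k with
    | zero =>
      intro X hX hL hk
      have hno : ∀ j, Z.touch j → (Z.s j).fT 1 ∉ X := by
        intro j hj hjX
        have hj1 := (Z.tch j hj).1
        have : j ∈ ((Finset.range n).filter fun j => Z.touch j ∧ (Z.s j).fT 1 ∈ X) := by
          simp only [Finset.mem_filter, Finset.mem_range]
          exact ⟨by omega, hj, hjX⟩
        have := Finset.card_pos.2 ⟨j, this⟩
        omega
      rw [tau_eq_iUnion X]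
      conv => arg 1; rw [Lev.eq_iUnion hX]
      have hdT : ∀ c, c < n → ∀ c', c' < n → c ≠ c' →
          Disjoint ((Z.s c).fT '' (((Z.s c).fT ⁻¹' X) ∩ Z.T))
            ((Z.s c').fT '' (((Z.s c').fT ⁻¹' X) ∩ Z.T)) := by
        have : ∀ c c', c < c' → c' < n →
          Disjoint ((Z.s c).fT '' (((Z.s c).fT ⁻¹' X) ∩ Z.T))
            ((Z.s c').fT '' (((Z.s c').fT ⁻¹' X) ∩ Z.T)) := by
          intro c c' hcc hc'
          rw [Set.disjoint_left]
          rintro _ ⟨x, ⟨hx, hxT⟩, rfl⟩ ⟨y, ⟨hy, hyT⟩, hxy⟩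
          have := Z.sep c c' hcc hc' x hxT y hyT hxy.symm
          refine hno c this.2.1 ?_
          rw [Set.mem_preimage, this.2.2.1] at hx
          exact hx
        intro c hc c' hc' hcc
        rcases lt_or_gt_of_ne hcc with h | h
        · exact this c c' h hc'
        · exact (this c' c h hc).symm
      have hfs : ∀ s : Finset ℕ, (∀ c ∈ s, c < n) →
          G (⋃ c ∈ s, (Z.s c).fT '' (((Z.s c).fT ⁻¹' X) ∩ Z.T))
            (⋃ c ∈ s, (Z.s c).fD '' Z.tau (((Z.s c).fT ⁻¹' X) ∩ Z.T)) := by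
        intro s
        induction s using Finset.induction_on with
        | empty => intro _; simpa using G0
        | insert c s hcs ih =>
          intro hs
          have hc : c < n := hs c (Finset.mem_insert_self c s)
          have hs' : ∀ c ∈ s, c < n := fun c hc => hs c (Finset.mem_insert_of_mem hc)
          rw [Finset.set_biUnion_insert, Finset.set_biUnion_insert]
          refine Gu _ _ _ _ (h1 c hc _ Set.inter_subset_right (hL c hc).inter_T) (ih hs') ?_ ?_
          · simp only [Set.disjoint_iUnion_right]
            intro c' hc'
            exact hdT c hc c' (hs' c' hc') fun h => hcs (h ▸ hc')
          · simp only [Set.disjoint_iUnion_right]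
            intro c' hc'
            rw [Set.disjoint_left]
            rintro _ ⟨x, hx, rfl⟩ ⟨y, hy, hxy⟩
            have := Z.dD c' (hs' c' hc') c hc y hy.1 x hx.1 hxy
            exact hcs (this ▸ hc')
      exact hfs _ fun c hc => Finset.mem_range.1 hc
    | succ k ih =>
      intro X hX hL hk
      by_cases hne : ∃ j, Z.touch j ∧ (Z.s j).fT 1 ∈ X
      · obtain ⟨j, hj, hjX⟩ := hne
        obtain ⟨hj1, hj2⟩ := Z.tch j hj
        have hsub : T2 A B j M M ⊆ X := by
          rintro _ (⟨y, hy, rfl⟩ | ⟨y, hy, rfl⟩)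
          · refine A.RR_min M _ (hL j (by omega)) ?_ hy
            rw [Set.mem_preimage, hA]; exact hjX
          · refine B.RR_min M _ (hL (j + 1) (by omega)) ?_ hy
            rw [Set.mem_preimage, hB, ← hj2]; exact hjX
        have e1 : X = T2 A B j M M ∪ (X \ T2 A B j M M) := (Set.union_sdiff_cancel hsub).symm
        have e2 : Z.tau X = Z.tau (T2 A B j M M) ∪ Z.tau (X \ T2 A B j M M) := by
          rw [← Z.tau_union, ← e1]
        rw [e2]
        conv => arg 1; rw [e1]
        refine Gu _ _ _ _ (h2 j hj) (ih _ (Set.sdiff_subset.trans hX)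
          (hL.diff (T2_lev A B hA hB hj M)) ?_) Set.disjoint_sdiff_right
          (Z.tau_disj Set.disjoint_sdiff_right)
        refine Nat.le_of_lt_succ (lt_of_lt_of_le (Finset.card_lt_card ?_) hk)
        rw [Finset.ssubset_iff_of_subset]
        · refine ⟨j, ?_, ?_⟩
          · simp only [Finset.mem_filter, Finset.mem_range]
            exact ⟨by omega, hj, hjX⟩
          · simp only [Finset.mem_filter, Finset.mem_range, not_and]
            intro _ _ hh
            refine hh.2 (Or.inl ⟨1, ?_, rfl⟩)
            have := A.z_RR M
            rwa [hA] at this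
        · intro i hi
          simp only [Finset.mem_filter, Finset.mem_range] at hi ⊢
          exact ⟨hi.1, hi.2.1, hi.2.2.1⟩
      · push Not at hne
        refine ih X hX hL ?_
        rw [Finset.card_eq_zero.2]
        · exact Nat.zero_le k
        · rw [Finset.filter_eq_empty_iff]
          intro i _ hh
          exact hne i hh.1 hh.2
  intro X hX hL
  exact main _ X hX hL le_rfl

end T2

end Sys

/-! ### Part 3: decompositions and substitution -/

/-- Every strictly contracted copy of the pair decomposes. -/
def WDec (𝓑 : Set (Set ℝ × Set ℝ)) (X Y : Set ℝ) : Prop :=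
  ∀ s : SimP, 0 < s.r → s.r < 1 → DecLt 𝓑 (s.fT '' X) (s.fD '' Y)

namespace WDec

variable {𝓑 : Set (Set ℝ × Set ℝ)}

lemma empty : WDec 𝓑 ∅ ∅ := by
  intro s _ _
  rw [Set.image_empty, Set.image_empty]
  exact DecLt.empty

lemma union {X Y X' Y' : Set ℝ} (h : WDec 𝓑 X Y) (h' : WDec 𝓑 X' Y') (hX : Disjoint X X')
    (hY : Disjoint Y Y') : WDec 𝓑 (X ∪ X') (Y ∪ Y') := by
  intro s h0 h1
  rw [Set.image_union, Set.image_union]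
  exact (h s h0 h1).union (h' s h0 h1) ((Set.disjoint_image_iff (s.inj_fT h0)).2 hX)
    ((Set.disjoint_image_iff (s.inj_fD h0)).2 hY)

lemma of_mem {X Y : Set ℝ} (hp : (X, Y) ∈ 𝓑) : WDec 𝓑 X Y :=
  fun s h0 h1 => DecLt.base hp s h0 h1

lemma comp {X Y : Set ℝ} (h : WDec 𝓑 X Y) (t : SimP) (h0 : 0 < t.r) (h1 : t.r ≤ 1) :
    WDec 𝓑 (t.fT '' X) (t.fD '' Y) := by
  intro s hs0 hs1
  rw [← SimP.mul_fT_image, ← SimP.mul_fD_image]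
  refine h _ (mul_pos hs0 h0) ?_
  calc s.r * t.r ≤ s.r * 1 := mul_le_mul_of_nonneg_left h1 hs0.le
    _ < 1 := by linarith

end WDec

namespace SimP

/-- Take the two similarities from two different pairs with the same ratio. -/
def mix (s s' : SimP) : SimP := ⟨s.r, s.b, s'.d⟩

lemma mix_fT (s s' : SimP) : (s.mix s').fT = s.fT := rfl

lemma mix_fD (s s' : SimP) (h : s.r = s'.r) : (s.mix s').fD = s'.fD := by
  funext x; simp only [mix, fD, h]

end SimP

/-- The data of one swap. -/
structure Swap (𝓑 : Set (Set ℝ × Set ℝ)) (R R' L L' : Set ℝ) (e f g : SimP) (z1 z2 : ℝ) : Prop where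
  er : 0 < e.r
  er1 : e.r < 1
  ef : f.r = e.r
  gr : 0 < g.r
  gr1 : g.r ≤ 1
  eR : e.fT '' R ⊆ R
  gL : g.fT '' L ⊆ R
  eg : Disjoint (e.fT '' R) (g.fT '' L)
  eR' : e.fD '' R' ⊆ R'
  gL' : g.fD '' L' ⊆ R'
  eg' : Disjoint (e.fD '' R') (g.fD '' L')
  fL : f.fT '' L ⊆ L
  fL' : f.fD '' L' ⊆ L'
  z1R : z1 ∈ R
  z2L : z2 ∈ L
  ez : e.fT z1 = z1
  fz : f.fT z2 = z2
  W1 : WDec 𝓑 (R \ (e.fT '' R ∪ g.fT '' L)) (R' \ (e.fD '' R' ∪ g.fD '' L'))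
  W2 : WDec 𝓑 (L \ f.fT '' L) (L' \ f.fD '' L')
  W3 : WDec 𝓑 L L'

namespace Swap

variable {𝓑 : Set (Set ℝ × Set ℝ)} {R R' L L' : Set ℝ} {e f g : SimP} {z1 z2 : ℝ}

/-- Admissible positions. -/
structure Adm (R R' L L' : Set ℝ) (g : SimP) (z1 z2 : ℝ) (U V : SimP) : Prop where
  r0 : 0 < U.r
  r1 : U.r < 1
  rV : V.r = U.r * g.r
  H : ∀ x ∈ R, ∀ y ∈ L, U.fT x = V.fT y → x = z1 ∧ y = z2
  dD : Disjoint (U.fD '' R') (V.fD '' L')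

def nextV (f g U V : SimP) : SimP := (V.mul f).mix ((U.mul g).mul f)

lemma nextV_fT : (nextV f g U V).fT = (V.mul f).fT := rfl

lemma nextV_fD {U V : SimP} (h : V.r = U.r * g.r) : (nextV f g U V).fD = ((U.mul g).mul f).fD := by
  apply SimP.mix_fD
  simp only [SimP.mul, h]

lemma Adm.next (S : Swap 𝓑 R R' L L' e f g z1 z2) {U V : SimP} (h : Adm R R' L L' g z1 z2 U V) :
    Adm R R' L L' g z1 z2 (U.mul e) (nextV f g U V) where
  r0 := mul_pos h.r0 S.er
  r1 := by
    have := mul_lt_mul_of_pos_left S.er1 h.r0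
    simp only [SimP.mul]
    linarith [h.r1]
  rV := by
    simp only [SimP.mul, nextV, SimP.mix, h.rV, S.ef]; ring
  H := by
    intro x hx y hy hxy
    rw [nextV_fT, SimP.mul_fT, SimP.mul_fT] at hxy
    obtain ⟨h1, h2⟩ := h.H _ (S.eR ⟨x, hx, rfl⟩) _ (S.fL ⟨y, hy, rfl⟩) hxy
    refine ⟨e.inj_fT S.er (h1.trans S.ez.symm), f.inj_fT (S.ef ▸ S.er) (h2.trans S.fz.symm)⟩
  dD := by
    rw [nextV_fD h.rV, SimP.mul_fD_image, SimP.mul_fD_image, SimP.mul_fD_image,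
      Set.disjoint_image_iff (U.inj_fD h.r0)]
    exact S.eg'.mono_right (Set.image_mono S.fL')

lemma step (S : Swap 𝓑 R R' L L' e f g z1 z2) {U V : SimP} (h : Adm R R' L L' g z1 z2 U V)
    (hn : DecLt 𝓑 ((U.mul e).fT '' R ∪ (nextV f g U V).fT '' L)
      ((U.mul e).fD '' R' ∪ (nextV f g U V).fD '' L')) :
    DecLt 𝓑 (U.fT '' R ∪ V.fT '' L) (U.fD '' R' ∪ V.fD '' L') := by
  have iU := U.inj_fT h.r0
  have iU' := U.inj_fD h.r0
  have hV0 : 0 < V.r := h.rV ▸ mul_pos h.r0 S.gr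
  have hV1 : V.r < 1 := by
    rw [h.rV]
    calc U.r * g.r ≤ U.r * 1 := mul_le_mul_of_nonneg_left S.gr1 h.r0.le
      _ < 1 := by linarith [h.r1]
  have iV := V.inj_fT hV0
  have iV' := V.inj_fD hV0
  have hz1 : z1 ∈ e.fT '' R := ⟨z1, S.z1R, S.ez⟩
  have hz2 : z2 ∈ f.fT '' L := ⟨z2, S.z2L, S.fz⟩
  have B1 := S.W1 U h.r0 h.r1
  have B2 := S.W2 (V.mix (U.mul g)) hV0 hV1
  have B3 := S.W3 ((U.mul g).mix V) (mul_pos h.r0 S.gr) (by rw [SimP.mix, SimP.mul, ← h.rV]; exact hV1)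
  rw [SimP.mix_fT, SimP.mix_fD _ _ h.rV, SimP.mul_fD_image] at B2
  rw [SimP.mix_fT, SimP.mix_fD _ _ h.rV.symm, SimP.mul_fT_image] at B3
  rw [nextV_fT, nextV_fD h.rV, SimP.mul_fT_image, SimP.mul_fT_image, SimP.mul_fD_image,
    SimP.mul_fD_image, SimP.mul_fD_image] at hn
  have key := ((hn.union B1 ?_ ?_).union B2 ?_ ?_).union B3 ?_ ?_
  · convert key using 1
    · have e1 : R = e.fT '' R ∪ (R \ (e.fT '' R ∪ g.fT '' L)) ∪ g.fT '' L := by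
        have h1 := S.eR
        have h2 := S.gL
        ext x
        have h1' := @h1 x
        have h2' := @h2 x
        simp only [Set.mem_union, Set.mem_sdiff]
        tauto
      have e2 : L = f.fT '' L ∪ (L \ f.fT '' L) := (Set.union_sdiff_cancel S.fL).symm
      have e3 : V.fT '' L = V.fT '' (f.fT '' L) ∪ V.fT '' (L \ f.fT '' L) := by
        rw [← Set.image_union, ← e2]
      have e4 : U.fT '' R = U.fT '' (e.fT '' R) ∪ U.fT '' (R \ (e.fT '' R ∪ g.fT '' L)) ∪
          U.fT '' (g.fT '' L) := by
        rw [← Set.image_union, ← Set.image_union, ← e1]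
      rw [e4, e3]
      ext x
      simp only [Set.mem_union]
      tauto
    · have e1 : R' = e.fD '' R' ∪ (R' \ (e.fD '' R' ∪ g.fD '' L')) ∪ g.fD '' L' := by
        have h1 := S.eR'
        have h2 := S.gL'
        ext x
        have h1' := @h1 x
        have h2' := @h2 x
        simp only [Set.mem_union, Set.mem_sdiff]
        tauto
      have e2 : L' = f.fD '' L' ∪ (L' \ f.fD '' L') := (Set.union_sdiff_cancel S.fL').symm
      have e3 : U.fD '' (g.fD '' L') = U.fD '' (g.fD '' (f.fD '' L')) ∪
          U.fD '' (g.fD '' (L' \ f.fD '' L')) := by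
        rw [← Set.image_union, ← Set.image_union, ← e2]
      have e4 : U.fD '' R' = U.fD '' (e.fD '' R') ∪ U.fD '' (R' \ (e.fD '' R' ∪ g.fD '' L')) ∪
          U.fD '' (g.fD '' L') := by
        rw [← Set.image_union, ← Set.image_union, ← e1]
      rw [e4, e3]
      ext x
      simp only [Set.mem_union]
      tauto
  · rw [Set.disjoint_union_left]
    constructor
    · rw [Set.disjoint_image_iff iU]
      exact Set.disjoint_sdiff_right.mono_left Set.subset_union_left
    · rw [Set.disjoint_left]
      rintro _ ⟨y, hy, rfl⟩ ⟨x, hx, hxy⟩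
      have := h.H x hx.1 y (S.fL hy) hxy
      exact hx.2 (Or.inl (this.1 ▸ hz1))
  · rw [Set.disjoint_union_left, Set.disjoint_image_iff iU', Set.disjoint_image_iff iU']
    exact ⟨Set.disjoint_sdiff_right.mono_left Set.subset_union_left,
      Set.disjoint_sdiff_right.mono_left
        ((Set.image_mono S.fL').trans Set.subset_union_right)⟩
  · rw [Set.disjoint_union_left, Set.disjoint_union_left]
    refine ⟨⟨?_, ?_⟩, ?_⟩
    · rw [Set.disjoint_left]
      rintro _ ⟨x, hx, rfl⟩ ⟨y, hy, hxy⟩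
      have := h.H x (S.eR hx) y hy.1 hxy.symm
      exact hy.2 (this.2 ▸ hz2)
    · rw [Set.disjoint_image_iff iV]
      exact Set.disjoint_sdiff_right
    · rw [Set.disjoint_left]
      rintro _ ⟨x, hx, rfl⟩ ⟨y, hy, hxy⟩
      have := h.H x hx.1 y hy.1 hxy.symm
      exact hy.2 (this.2 ▸ hz2)
  · have hg : g.fD '' (L' \ f.fD '' L') ⊆ g.fD '' L' := Set.image_mono Set.sdiff_subset
    rw [Set.disjoint_union_left, Set.disjoint_union_left, Set.disjoint_image_iff iU',
      Set.disjoint_image_iff iU', Set.disjoint_image_iff iU', Set.disjoint_image_iff (g.inj_fD S.gr)]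
    exact ⟨⟨S.eg'.mono_right hg, Set.disjoint_sdiff_right⟩,
      Set.disjoint_sdiff_left.mono_right (hg.trans Set.subset_union_right)⟩
  · rw [Set.disjoint_union_left, Set.disjoint_union_left, Set.disjoint_union_left]
    have hv : ∀ Y ⊆ L, Disjoint (V.fT '' Y) (U.fT '' (g.fT '' L)) := by
      intro Y hY
      rw [Set.disjoint_left]
      rintro _ ⟨y, hy, rfl⟩ ⟨x, hx, hxy⟩
      have := h.H x (S.gL hx) y (hY hy) hxy
      exact Set.disjoint_left.1 S.eg hz1 (this.1 ▸ hx)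
    rw [Set.disjoint_image_iff iU, Set.disjoint_image_iff iU]
    exact ⟨⟨⟨S.eg, hv _ S.fL⟩, Set.disjoint_sdiff_left.mono_right Set.subset_union_right⟩,
      hv _ Set.sdiff_subset⟩
  · have hh : ∀ Y ⊆ R', Disjoint (U.fD '' Y) (V.fD '' L') := fun Y hY =>
      h.dD.mono_left (Set.image_mono hY)
    rw [Set.disjoint_union_left, Set.disjoint_union_left, Set.disjoint_union_left]
    exact ⟨⟨⟨hh _ S.eR', hh _ ((Set.image_mono S.fL').trans S.gL')⟩, hh _ Set.sdiff_subset⟩,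
      hh _ ((Set.image_mono Set.sdiff_subset).trans S.gL')⟩

lemma main (S : Swap 𝓑 R R' L L' e f g z1 z2) {U V : SimP} (h : Adm R R' L L' g z1 z2 U V)
    (hz : U.fT z1 = V.fT z2)
    (hm : ((U.mul e).fT '' R ∪ (nextV f g U V).fT '' L,
      (U.mul e).fD '' R' ∪ (nextV f g U V).fD '' L') ∈ 𝓑) :
    DecLt 𝓑 ((U.mul e).fT '' R ∪ (nextV f g U V).fT '' L)
      ((U.mul e).fD '' R' ∪ (nextV f g U V).fD '' L') ∧
    DecLt 𝓑 (U.fT '' R ∪ V.fT '' L) (U.fD '' R' ∪ V.fD '' L') := by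
  have h1 := Adm.next S h
  have hd : DecLt 𝓑 ((U.mul e).fT '' R ∪ (nextV f g U V).fT '' L)
      ((U.mul e).fD '' R' ∪ (nextV f g U V).fD '' L') := by
    refine step S h1 ?_
    let κ : SimP := ⟨e.r, (1 - e.r) * U.fT z1, U.d + U.r * e.d - e.r * U.d⟩
    have := DecLt.base hm κ S.er S.er1
    convert this using 1
    · rw [Set.image_union, nextV_fT, nextV_fT, SimP.mul_fT_image, SimP.mul_fT_image,
        SimP.mul_fT_image, SimP.mul_fT_image, nextV_fT, SimP.mul_fT_image]
      have k1 : ∀ X : Set ℝ, κ.fT '' (U.fT '' X) = U.fT '' (e.fT '' X) := by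
        intro X
        rw [Set.image_image, Set.image_image]
        refine Set.image_congr fun x _ => ?_
        have := S.ez
        simp only [SimP.fT, κ] at this ⊢
        linear_combination (-U.r) * this
      have k2 : ∀ X : Set ℝ, κ.fT '' (V.fT '' X) = V.fT '' (f.fT '' X) := by
        intro X
        rw [Set.image_image, Set.image_image]
        refine Set.image_congr fun x _ => ?_
        have := S.fz
        have h3 := S.ef
        simp only [SimP.fT, κ] at this hz ⊢
        rw [h3] at this ⊢
        linear_combination (-V.r) * this + (1 - e.r) * hz
      rw [k1, SimP.mul_fT_image, k2]
    · rw [Set.image_union, nextV_fD h1.rV, nextV_fD h.rV]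
      simp only [SimP.mul_fD_image]
      have k1 : ∀ X : Set ℝ, κ.fD '' (U.fD '' X) = U.fD '' (e.fD '' X) := by
        intro X
        rw [Set.image_image, Set.image_image]
        refine Set.image_congr fun x _ => ?_
        simp only [SimP.fD, κ]
        ring
      rw [k1, k1]
  exact ⟨hd, step S h hd⟩

end Swap

namespace Sys

variable {n : ℕ} {Z : Sys n}

lemma wdec_lev (A B : Z.EndD) (hA : A.z = 1) (hB : B.z = 0) {𝓑 : Set (Set ℝ × Set ℝ)} {K : ℕ}
    (b1 : ∀ X, X ⊆ Z.T → Z.Lev 1 X → (X, Z.tau X) ∈ 𝓑)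
    (b2 : ∀ j, Z.touch j → ∀ M, M ≤ K → (T2 A B j M M, Z.tau (T2 A B j M M)) ∈ 𝓑) :
    ∀ N, N ≤ K + 2 → ∀ X, X ⊆ Z.T → Z.Lev N X → WDec 𝓑 X (Z.tau X) := by
  intro N
  induction N with
  | zero => exact fun _ X hX hL => WDec.of_mem (b1 X hX hL.succ)
  | succ N ih =>
    cases N with
    | zero => exact fun _ X hX hL => WDec.of_mem (b1 X hX hL)
    | succ M =>
      intro hM
      refine peel A B hA hB (WDec 𝓑) WDec.empty (fun X Y X' Y' h h' h1 h2 => h.union h' h1 h2) M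
        (fun j hj => WDec.of_mem (b2 j hj M (by omega))) ?_
      intro c hc X hX hL
      exact (ih (by omega) X hX hL).comp _ (Z.rpos c hc) (Z.rlt c hc).le

lemma EndD.pow_pos (P : Z.EndD) (m : ℕ) : 0 < ((Z.s P.e).pow m).r := by
  rw [SimP.pow_r]; exact _root_.pow_pos (Z.rpos _ P.en) m

lemma EndD.pow_le (P : Z.EndD) (m : ℕ) : ((Z.s P.e).pow m).r ≤ 1 := by
  rw [SimP.pow_r]; exact pow_le_one₀ (Z.rpos _ P.en).le (Z.rlt _ P.en).le

lemma EndD.wdec_ann (P : Z.EndD) {𝓑 : Set (Set ℝ × Set ℝ)}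
    (h : WDec 𝓑 (P.R \ P.RR 1) (Z.tau (P.R \ P.RR 1))) (M a : ℕ) (hMa : M ≤ a) :
    WDec 𝓑 (P.RR M \ P.RR a) (Z.tau (P.RR M \ P.RR a)) := by
  induction hMa with
  | refl => rw [Set.sdiff_self, tau_empty]; exact WDec.empty
  | @step a hMa ih =>
    have e1 : P.RR M \ P.RR (a + 1) = (P.RR M \ P.RR a) ∪ (P.RR a \ P.RR (a + 1)) := by
      have h1 := P.RR_anti hMa
      have h2 := P.RR_anti (Nat.le_succ a)
      ext x
      have h1' := @h1 x
      have h2' := @h2 x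
      simp only [Set.mem_union, Set.mem_sdiff]
      tauto
    rw [Nat.succ_eq_add_one, e1, tau_union]
    have hd : Disjoint (P.RR M \ P.RR a) (P.RR a \ P.RR (a + 1)) :=
      Set.disjoint_sdiff_left.mono_right Set.sdiff_subset
    refine ih.union ?_ hd (Z.tau_disj hd)
    have e2 : P.RR a \ P.RR (a + 1) = ((Z.s P.e).pow a).fT '' (P.R \ P.RR 1) := by
      rw [Set.image_sdiff (SimP.inj_fT _ (P.pow_pos a)), EndD.RR, EndD.RR, EndD.RR, SimP.pow_add_fT]
    have e3 : Z.tau (P.RR a \ P.RR (a + 1)) = ((Z.s P.e).pow a).fD '' Z.tau (P.R \ P.RR 1) := by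
      rw [tau_diff, tau_diff, P.RR_tau, P.RR_tau, P.RR_tau,
        Set.image_sdiff (SimP.inj_fD _ (P.pow_pos a)), SimP.pow_add_fD]
    rw [e3, e2]
    exact h.comp _ (P.pow_pos a) (P.pow_le a)

/-- A substitution for the touching point between `i1` and `i2`. -/
structure SubOK (E1 E2 : Z.EndD) (i1 i2 Nb : ℕ) (g : SimP) (q p : ℕ) : Prop where
  q1 : 1 ≤ q
  qN : q + 1 ≤ Nb
  pN : p + 1 ≤ Nb
  qp : (Z.s E1.e).r ^ q = (Z.s E2.e).r ^ p
  gr : 0 < g.r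
  gr1 : g.r ≤ 1
  gR : g.fT '' E2.R ⊆ E1.R
  gtau : Z.tau (g.fT '' E2.R) = g.fD '' Z.tau E2.R
  glev : Z.Lev Nb (g.fT '' E2.R)
  gdis : Disjoint (E1.RR q) (g.fT '' E2.R)
  big : ∀ K, ∃ a b, K ≤ a ∧ K ≤ b ∧
    (Z.s i2).r * (Z.s E2.e).r ^ b = (Z.s i1).r * (Z.s E1.e).r ^ a * g.r

lemma EndD.compactR (E : Z.EndD) : IsCompact E.R ∧ IsCompact (Z.tau E.R) ∧ (Z.tau E.R).Nonempty := by
  have := Lev.compact E.RT E.lev1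
  exact ⟨this.1, this.2.1, this.2.2.1 ⟨_, E.zR⟩⟩

lemma sub_dec (E1 E2 : Z.EndD) {i1 i2 Nb q p : ℕ} {g : SimP} (S : SubOK E1 E2 i1 i2 Nb g q p)
    (hi1 : i1 < n) (hi2 : i2 < n) (hne : i1 ≠ i2) (hz : (Z.s i1).fT E1.z = (Z.s i2).fT E2.z)
    (hsep : ∀ x ∈ Z.T, ∀ y ∈ Z.T, (Z.s i1).fT x = (Z.s i2).fT y → x = E1.z ∧ y = E2.z)
    (K : ℕ) (hK : Nb ≤ K + 2) :
    ∃ P : Set ℝ × Set ℝ, (IsCompact P.1 ∧ IsCompact P.2 ∧ (P.1.Nonempty ↔ P.2.Nonempty)) ∧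
      ∀ 𝓑 : Set (Set ℝ × Set ℝ),
        (∀ N, N ≤ K + 2 → ∀ X, X ⊆ Z.T → Z.Lev N X → WDec 𝓑 X (Z.tau X)) → P ∈ 𝓑 →
        DecLt 𝓑 P.1 P.2 ∧ ∀ M, M ≤ K → DecLt 𝓑 ((Z.s i1).fT '' E1.RR M ∪ (Z.s i2).fT '' E2.RR M)
          ((Z.s i1).fD '' Z.tau (E1.RR M) ∪ (Z.s i2).fD '' Z.tau (E2.RR M)) := by
  obtain ⟨a, b, ha, hb, hab⟩ := S.big K
  set e := (Z.s E1.e).pow q with he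
  set f := (Z.s E2.e).pow p with hf
  set U := (Z.s i1).mul ((Z.s E1.e).pow a) with hU
  set V := (Z.s i2).mul ((Z.s E2.e).pow b) with hV
  obtain ⟨c1, c2, c3⟩ := E1.compactR
  obtain ⟨c4, c5, c6⟩ := E2.compactR
  refine ⟨((U.mul e).fT '' E1.R ∪ (Swap.nextV f g U V).fT '' E2.R,
      (U.mul e).fD '' Z.tau E1.R ∪ (Swap.nextV f g U V).fD '' Z.tau E2.R), ⟨?_, ?_, ?_, ?_⟩, ?_⟩
  · exact (c1.image (SimP.continuous_fT _)).union (c4.image (SimP.continuous_fT _))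
  · exact (c2.image (SimP.continuous_fD _)).union (c5.image (SimP.continuous_fD _))
  · exact fun _ => (c3.image _).inl
  · exact fun _ => Set.Nonempty.inl ⟨_, E1.z, E1.zR, rfl⟩
  intro 𝓑 hw hP
  have teR : e.fD '' Z.tau E1.R = Z.tau (e.fT '' E1.R) := (E1.RR_tau q).symm
  have tfL : f.fD '' Z.tau E2.R = Z.tau (f.fT '' E2.R) := (E2.RR_tau p).symm
  have sw : Swap 𝓑 E1.R (Z.tau E1.R) E2.R (Z.tau E2.R) e f g E1.z E2.z := by
    refine ⟨E1.pow_pos q, ?_, ?_, S.gr, S.gr1, E1.RR_sub q, S.gR, S.gdis, ?_, ?_, ?_, E2.RR_sub p,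
      ?_, E1.zR, E2.zR, SimP.pow_fix _ _ E1.hz q, SimP.pow_fix _ _ E2.hz p, ?_, ?_, ?_⟩
    · rw [he, SimP.pow_r]
      exact pow_lt_one₀ (Z.rpos _ E1.en).le (Z.rlt _ E1.en) (by have := S.q1; omega)
    · rw [he, hf, SimP.pow_r, SimP.pow_r, S.qp]
    · rw [teR]; exact Z.tau_mono (E1.RR_sub q)
    · rw [← S.gtau]; exact Z.tau_mono S.gR
    · rw [teR, ← S.gtau]; exact Z.tau_disj S.gdis
    · rw [tfL]; exact Z.tau_mono (E2.RR_sub p)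
    · rw [teR, ← S.gtau, ← tau_union, ← tau_diff]
      refine hw Nb hK _ (Set.sdiff_subset.trans E1.RT) ?_
      exact (E1.lev1.mono (by have := S.qN; omega)).diff (((E1.RR_lev q).mono S.qN).union S.glev)
    · rw [tfL, ← tau_diff]
      refine hw Nb hK _ (Set.sdiff_subset.trans E2.RT) ?_
      exact (E2.lev1.mono (by have := S.qN; omega)).diff ((E2.RR_lev p).mono S.pN)
    · exact hw 1 (by omega) _ E2.RT E2.lev1
  have UR : U.fT '' E1.R = (Z.s i1).fT '' E1.RR a := SimP.mul_fT_image _ _ _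
  have VL : V.fT '' E2.R = (Z.s i2).fT '' E2.RR b := SimP.mul_fT_image _ _ _
  have UR' : U.fD '' Z.tau E1.R = (Z.s i1).fD '' Z.tau (E1.RR a) := by
    rw [hU, SimP.mul_fD_image, E1.RR_tau]
  have VL' : V.fD '' Z.tau E2.R = (Z.s i2).fD '' Z.tau (E2.RR b) := by
    rw [hV, SimP.mul_fD_image, E2.RR_tau]
  have dDis : ∀ X X', Disjoint ((Z.s i1).fD '' Z.tau X) ((Z.s i2).fD '' Z.tau X') := by
    intro X X'
    rw [Set.disjoint_left]
    rintro _ ⟨x, hx, rfl⟩ ⟨y, hy, hxy⟩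
    exact hne (Z.dD i1 hi1 i2 hi2 x hx.1 y hy.1 hxy.symm)
  have adm : Swap.Adm E1.R (Z.tau E1.R) E2.R (Z.tau E2.R) g E1.z E2.z U V := by
    refine ⟨mul_pos (Z.rpos _ hi1) (E1.pow_pos a), ?_, ?_, ?_, ?_⟩
    · exact mul_lt_one_of_nonneg_of_lt_one_left (Z.rpos _ hi1).le (Z.rlt _ hi1) (E1.pow_le a)
    · simp only [hU, hV, SimP.mul, SimP.pow_r]
      exact hab
    · intro x hx y hy hxy
      rw [hU, hV, SimP.mul_fT, SimP.mul_fT] at hxy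
      obtain ⟨h1, h2⟩ := hsep _ (E1.RR_T a ⟨x, hx, rfl⟩) _ (E2.RR_T b ⟨y, hy, rfl⟩) hxy
      exact ⟨SimP.inj_fT _ (E1.pow_pos a) (h1.trans (SimP.pow_fix _ _ E1.hz a).symm),
        SimP.inj_fT _ (E2.pow_pos b) (h2.trans (SimP.pow_fix _ _ E2.hz b).symm)⟩
    · rw [UR', VL']
      exact dDis _ _
  have hUV : U.fT E1.z = V.fT E2.z := by
    rw [hU, hV, SimP.mul_fT, SimP.mul_fT, SimP.pow_fix _ _ E1.hz, SimP.pow_fix _ _ E2.hz, hz]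
  obtain ⟨m1, m2⟩ := sw.main adm hUV hP
  refine ⟨m1, fun M hM => ?_⟩
  rw [UR, VL, UR', VL'] at m2
  have k1 := (E1.wdec_ann (hw 2 (by omega) _ (Set.sdiff_subset.trans E1.RT)
    ((E1.lev1.mono (by omega)).diff (E1.RR_lev 1))) M a (by omega)) _ (Z.rpos _ hi1) (Z.rlt _ hi1)
  have k2 := (E2.wdec_ann (hw 2 (by omega) _ (Set.sdiff_subset.trans E2.RT)
    ((E2.lev1.mono (by omega)).diff (E2.RR_lev 1))) M b (by omega)) _ (Z.rpos _ hi2) (Z.rlt _ hi2)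
  have s1 := E1.RR_anti (show M ≤ a by omega)
  have s2 := E2.RR_anti (show M ≤ b by omega)
  have key := (m2.union k1 ?_ ?_).union k2 ?_ ?_
  · convert key using 1
    · conv_lhs => rw [← Set.union_sdiff_cancel s1, ← Set.union_sdiff_cancel s2]
      rw [Set.image_union, Set.image_union]
      ext x; simp only [Set.mem_union]; tauto
    · conv_lhs => rw [← Set.union_sdiff_cancel s1, ← Set.union_sdiff_cancel s2]
      rw [tau_union, tau_union, Set.image_union, Set.image_union]
      ext x; simp only [Set.mem_union]; tauto
  · rw [Set.disjoint_union_left, Set.disjoint_image_iff (SimP.inj_fT _ (Z.rpos _ hi1))]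
    refine ⟨Set.disjoint_sdiff_right, ?_⟩
    rw [Set.disjoint_left]
    rintro _ ⟨y, hy, rfl⟩ ⟨x, hx, hxy⟩
    have := hsep x (E1.RR_T M hx.1) y (E2.RR_T b hy) hxy
    exact hx.2 (this.1 ▸ E1.z_RR a)
  · rw [Set.disjoint_union_left, Set.disjoint_image_iff (SimP.inj_fD _ (Z.rpos _ hi1))]
    exact ⟨Z.tau_disj Set.disjoint_sdiff_right, (dDis _ _).symm⟩
  · rw [Set.disjoint_union_left, Set.disjoint_union_left,
      Set.disjoint_image_iff (SimP.inj_fT _ (Z.rpos _ hi2))]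
    refine ⟨⟨?_, Set.disjoint_sdiff_right⟩, ?_⟩ <;>
    · rw [Set.disjoint_left]
      rintro _ ⟨x, hx, rfl⟩ ⟨y, hy, hxy⟩
      have := hsep x (by first | exact E1.RR_T _ hx | exact E1.RR_T _ hx.1) y (E2.RR_T M hy.1) hxy.symm
      exact hy.2 (this.2 ▸ E2.z_RR b)
  · rw [Set.disjoint_union_left, Set.disjoint_union_left,
      Set.disjoint_image_iff (SimP.inj_fD _ (Z.rpos _ hi2))]
    exact ⟨⟨dDis _ _, Z.tau_disj Set.disjoint_sdiff_right⟩, dDis _ _⟩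

theorem sys_main (A B : Z.EndD) (hA : A.z = 1) (hB : B.z = 0)
    (hsub : ∀ j, Z.touch j → ∃ Nb g q p, SubOK A B j (j + 1) Nb g q p ∨ SubOK B A (j + 1) j Nb g q p) :
    LipEquivOn Z.D Z.T := by
  classical
  choose! Nb g q p hs using hsub
  set K := (Finset.range n).sup Nb with hK
  have hP : ∀ j, Z.touch j → ∃ P : Set ℝ × Set ℝ,
      (IsCompact P.1 ∧ IsCompact P.2 ∧ (P.1.Nonempty ↔ P.2.Nonempty)) ∧
      ∀ 𝓑 : Set (Set ℝ × Set ℝ),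
        (∀ N, N ≤ K + 2 → ∀ X, X ⊆ Z.T → Z.Lev N X → WDec 𝓑 X (Z.tau X)) → P ∈ 𝓑 →
        DecLt 𝓑 P.1 P.2 ∧ ∀ M, M ≤ K → DecLt 𝓑 (T2 A B j M M) (Z.tau (T2 A B j M M)) := by
    intro j hj
    obtain ⟨hj1, hj2⟩ := Z.tch j hj
    have hNb : Nb j ≤ K + 2 := by
      have : Nb j ≤ K := Finset.le_sup (f := Nb) (Finset.mem_range.2 (show j < n by omega))
      omega
    rcases hs j hj with h | h
    · obtain ⟨P, h1, h2⟩ := sub_dec A B h (by omega) (by omega) (by omega) (by rw [hA, hB]; exact hj2)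
        (by
          intro x hx y hy hxy
          have := Z.sep j (j + 1) (by omega) hj1 x hx y hy hxy
          rw [hA, hB]; exact this.2.2) K hNb
      refine ⟨P, h1, fun 𝓑 hw hp => ⟨(h2 𝓑 hw hp).1, fun M hM => ?_⟩⟩
      rw [T2_tau A B hA hB hj]
      exact (h2 𝓑 hw hp).2 M hM
    · obtain ⟨P, h1, h2⟩ := sub_dec B A h (by omega) (by omega) (by omega) (by rw [hA, hB]; exact hj2.symm)
        (by
          intro x hx y hy hxy
          have := Z.sep j (j + 1) (by omega) hj1 y hy x hx hxy.symm
          rw [hA, hB]; exact this.2.2.symm) K hNb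
      refine ⟨P, h1, fun 𝓑 hw hp => ⟨(h2 𝓑 hw hp).1, fun M hM => ?_⟩⟩
      rw [T2_tau A B hA hB hj, T2, Set.union_comm, Set.union_comm ((Z.s j).fD '' _)]
      exact (h2 𝓑 hw hp).2 M hM
  choose! P hPc hPd using hP
  set B1 : Set (Set ℝ × Set ℝ) := {x | ∃ X, X ⊆ Z.T ∧ Z.Lev 1 X ∧ x = (X, Z.tau X)} with hB1
  set B2 : Set (Set ℝ × Set ℝ) := {x | ∃ j, Z.touch j ∧ ∃ M, M ≤ K ∧
    x = (T2 A B j M M, Z.tau (T2 A B j M M))} with hB2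
  set B3 : Set (Set ℝ × Set ℝ) := {x | ∃ j, Z.touch j ∧ x = P j} with hB3
  set 𝓑 := B1 ∪ B2 ∪ B3 with h𝓑
  have b1 : ∀ X, X ⊆ Z.T → Z.Lev 1 X → (X, Z.tau X) ∈ 𝓑 := fun X hX hL =>
    Or.inl (Or.inl ⟨X, hX, hL, rfl⟩)
  have b2 : ∀ j, Z.touch j → ∀ M, M ≤ K → (T2 A B j M M, Z.tau (T2 A B j M M)) ∈ 𝓑 :=
    fun j hj M hM => Or.inl (Or.inr ⟨j, hj, M, hM, rfl⟩)
  have hw := wdec_lev A B hA hB b1 b2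
  have hd : ∀ j, Z.touch j → _ := fun j hj => hPd j hj 𝓑 hw (Or.inr ⟨j, hj, rfl⟩)
  refine (Z.tau_T ▸ matching 𝓑 ?_ ?_ ?_ (Z.T, Z.tau Z.T) (b1 _ subset_rfl lev_T.succ) :)
  · refine (Set.Finite.union ?_ ?_).union ?_
    · refine ((Finset.range n).powerset.finite_toSet.image fun s =>
        ((⋃ c ∈ s, (Z.s c).fT '' Z.T), Z.tau (⋃ c ∈ s, (Z.s c).fT '' Z.T))).subset ?_
      rintro _ ⟨X, hX, hL, rfl⟩
      refine ⟨(Finset.range n).filter fun c => (Z.s c).fT '' Z.T ⊆ X,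
        Finset.mem_coe.2 (Finset.mem_powerset.2 (Finset.filter_subset _ _)), ?_⟩
      have : (⋃ c ∈ (Finset.range n).filter fun c => (Z.s c).fT '' Z.T ⊆ X, (Z.s c).fT '' Z.T) = X := by
        ext x
        simp only [Set.mem_iUnion, Finset.mem_filter, Finset.mem_range, exists_prop]
        constructor
        · rintro ⟨c, ⟨_, h⟩, hx⟩; exact h hx
        · intro hx
          obtain ⟨c, hc, y, hy, rfl⟩ := (Z.invT x).1 (hX hx)
          refine ⟨c, ⟨hc, ?_⟩, y, hy, rfl⟩
          rcases hL c hc with h | h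
          · exact Set.image_subset_iff.2 h
          · exact (Set.disjoint_left.1 h hy hx).elim
      simp only [this]
    · refine (((Finset.range n) ×ˢ (Finset.range (K + 1))).finite_toSet.image fun s =>
        (T2 A B s.1 s.2 s.2, Z.tau (T2 A B s.1 s.2 s.2))).subset ?_
      rintro _ ⟨j, hj, M, hM, rfl⟩
      refine ⟨(j, M), ?_, rfl⟩
      have := (Z.tch j hj).1
      simp only [Finset.coe_product, Set.mem_prod, Finset.mem_coe, Finset.mem_range]
      omega
    · refine ((Finset.range n).finite_toSet.image P).subset ?_
      rintro _ ⟨j, hj, rfl⟩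
      have := (Z.tch j hj).1
      exact ⟨j, by simp only [Finset.mem_coe, Finset.mem_range]; omega, rfl⟩
  · rintro _ ((⟨X, hX, hL, rfl⟩ | ⟨j, hj, M, hM, rfl⟩) | ⟨j, hj, rfl⟩)
    · exact Lev.compact hX hL
    · exact Lev.compact (T2_sub A B hj M M) (T2_lev A B hA hB hj M)
    · exact hPc j hj
  · rintro _ ((⟨X, hX, hL, rfl⟩ | ⟨j, hj, M, hM, rfl⟩) | ⟨j, hj, rfl⟩)
    · refine peel A B hA hB (DecLt 𝓑) DecLt.empty (fun X Y X' Y' h h' h1 h2 => h.union h' h1 h2) 0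
        (fun j hj => (hd j hj).2 0 (Nat.zero_le _)) ?_ X hX hL.succ
      intro c hc X hX hL
      exact hw 1 (by omega) X hX hL _ (Z.rpos c hc) (Z.rlt c hc)
    · exact (hd j hj).2 M hM
    · exact (hd j hj).1

end Sys

namespace Sys

variable {n : ℕ} {Z : Sys n}

variable (Z) in
def wordS : List ℕ → SimP
  | [] => ⟨1, 0, 0⟩
  | c :: w => (Z.s c).mul (wordS w)

lemma wordS_pos (w : List ℕ) (hw : ∀ c ∈ w, c < n) : 0 < (Z.wordS w).r := by
  induction w with
  | nil => simp [wordS]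
  | cons c w ih =>
    exact mul_pos (Z.rpos c (hw c (by simp))) (ih fun c hc => hw c (List.mem_cons_of_mem _ hc))

lemma wordS_le (w : List ℕ) (hw : ∀ c ∈ w, c < n) : (Z.wordS w).r ≤ 1 := by
  induction w with
  | nil => simp [wordS]
  | cons c w ih =>
    have h2 : ∀ c ∈ w, c < n := fun c hc => hw c (List.mem_cons_of_mem _ hc)
    exact mul_le_one₀ (Z.rlt c (hw c (by simp))).le (wordS_pos w h2).le (ih h2)

lemma wordS_rep (e q : ℕ) (w : List ℕ) :
    (Z.wordS (List.replicate q e ++ w)).r = (Z.s e).r ^ q * (Z.wordS w).r := by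
  induction q with
  | zero => simp
  | succ q ih =>
    rw [List.replicate_succ, List.cons_append, wordS, SimP.mul, ih, pow_succ]
    ring

variable (Z) in
/-- Sets avoiding both end points. -/
def Inn (X : Set ℝ) : Prop := X ⊆ Z.T ∧ (0 : ℝ) ∉ X ∧ (1 : ℝ) ∉ X

lemma Inn.iso {X : Set ℝ} (h : Z.Inn X) {c : ℕ} (hc : c < n) : Z.Iso c X := by
  refine ⟨h.1, ?_⟩
  rintro c' hc' hcc x hx ⟨y, hy, hxy⟩
  rcases lt_or_gt_of_ne hcc with hl | hl
  · have := Z.sep c' c hl hc x hx y (h.1 hy) hxy.symm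
    exact h.2.1 (this.2.2.2 ▸ hy)
  · have := Z.sep c c' hl hc' y (h.1 hy) x hx hxy
    exact h.2.2 (this.2.2.1 ▸ hy)

lemma Inn.image {X : Set ℝ} (h : Z.Inn X) {c : ℕ} (hc : c < n) : Z.Inn ((Z.s c).fT '' X) := by
  have hn := Z.npos
  refine ⟨(h.iso hc).sub hc, ?_, ?_⟩
  · rintro ⟨y, hy, hy0⟩
    rcases Nat.eq_zero_or_pos c with rfl | hp
    · exact h.2.1 ((SimP.inj_fT _ (Z.rpos _ hc) (hy0.trans Z.fix0.symm)) ▸ hy)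
    · have := Z.sep 0 c hp hc 0 Z.zT y (h.1 hy) (Z.fix0.trans hy0.symm)
      exact h.2.1 (this.2.2.2 ▸ hy)
  · rintro ⟨y, hy, hy0⟩
    rcases Nat.lt_or_ge c (n - 1) with hp | hp
    · have := Z.sep c (n - 1) hp (by omega) y (h.1 hy) 1 Z.oT (hy0.trans Z.fix1.symm)
      exact h.2.2 (this.2.2.1 ▸ hy)
    · obtain rfl : c = n - 1 := by omega
      exact h.2.2 ((SimP.inj_fT _ (Z.rpos _ hc) (hy0.trans Z.fix1.symm)) ▸ hy)

lemma Inn.word {X : Set ℝ} (h : Z.Inn X) {N : ℕ} (hL : Z.Lev N X) (w : List ℕ)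
    (hw : ∀ c ∈ w, c < n) : Z.Inn ((Z.wordS w).fT '' X) ∧ Z.Lev (N + w.length) ((Z.wordS w).fT '' X) ∧
    Z.tau ((Z.wordS w).fT '' X) = (Z.wordS w).fD '' Z.tau X := by
  induction w with
  | nil =>
    have h1 : (Z.wordS []).fT = id := by funext x; simp [wordS, SimP.fT]
    have h2 : (Z.wordS []).fD = id := by funext x; simp [wordS, SimP.fD]
    rw [h1, h2, Set.image_id, Set.image_id]
    exact ⟨h, hL, rfl⟩
  | cons c w ih =>
    have hc := hw c (by simp)
    obtain ⟨i1, i2, i3⟩ := ih fun c hc => hw c (List.mem_cons_of_mem _ hc)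
    rw [wordS, SimP.mul_fT_image, SimP.mul_fD_image, ← i3]
    exact ⟨i1.image hc, (i1.iso hc).lev hc i2, (i1.iso hc).tau hc⟩

theorem subst_exists (E1 E2 : Z.EndD) (hz : (E1.z = 1 ∧ E2.z = 0) ∨ (E1.z = 0 ∧ E2.z = 1))
    {i1 i2 q p k k' a : ℕ} (hq : 1 ≤ q) (hp : 1 ≤ p) (hqp : (Z.s E1.e).r ^ q = (Z.s E2.e).r ^ p)
    (w : List ℕ) (hw : ∀ c ∈ w, c < n) (ha : a < n) (hfree : Z.Free E2.z a) (hae : a ≠ E2.e)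
    (heq : (Z.s i2).r * (Z.s E2.e).r ^ k =
      (Z.s i1).r * (Z.wordS w).r * (Z.s a).r * (Z.s E2.e).r ^ k') :
    ∃ Nb g q' p', SubOK E1 E2 i1 i2 Nb g q' p' := by
  have hopp : E1.z = 1 - E2.z := by
    rcases hz with ⟨h1, h2⟩ | ⟨h1, h2⟩ <;> rw [h1, h2] <;> norm_num
  have hiso : Z.Iso a (E2.RR k') := hfree.iso (E2.RR_T k') (E2.z'_RR k')
  set Y := (Z.s a).fT '' E2.RR k' with hY
  have y2 : E2.z ∉ Y := by
    rintro ⟨x, hx, hx2⟩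
    have := hfree E2.e E2.en hae.symm E2.z E2.zT x (E2.RR_T k' hx) (E2.hz.trans hx2.symm)
    exact E2.z'_RR k' (this ▸ hx)
  have y1 : E1.z ∉ Y := by
    rintro ⟨x, hx, hx2⟩
    by_cases h : a = E1.e
    · subst h
      have := SimP.inj_fT _ (Z.rpos _ ha) (hx2.trans E1.hz.symm)
      rw [hopp] at this
      exact E2.z'_RR k' (this ▸ hx)
    · have := hfree E1.e E1.en (Ne.symm h) E1.z E1.zT x (E2.RR_T k' hx) (E1.hz.trans hx2.symm)
      exact E2.z'_RR k' (this ▸ hx)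
  have hinn : Z.Inn Y := by
    refine ⟨hiso.sub ha, ?_⟩
    rcases hz with ⟨h1, h2⟩ | ⟨h1, h2⟩
    · rw [h1] at y1; rw [h2] at y2; exact ⟨y2, y1⟩
    · rw [h1] at y1; rw [h2] at y2; exact ⟨y1, y2⟩
  have hYl : Z.Lev (k' + 2) Y := hiso.lev ha (E2.RR_lev k')
  have hYt : Z.tau Y = (Z.s a).fD '' Z.tau (E2.RR k') := hiso.tau ha
  set W := List.replicate q E1.e ++ w with hW
  have hWn : ∀ c ∈ W, c < n := by
    intro c hc
    rcases List.mem_append.1 hc with h | h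
    · rw [List.eq_of_mem_replicate h]; exact E1.en
    · exact hw c h
  obtain ⟨c1, c2, c3⟩ := hinn.word hYl W hWn
  set g := (Z.wordS W).mul ((Z.s a).mul ((Z.s E2.e).pow k')) with hg
  have gC : g.fT '' E2.R = (Z.wordS W).fT '' Y := by
    rw [hg, SimP.mul_fT_image, SimP.mul_fT_image]; rfl
  set N := k' + 2 + W.length with hN
  have gr : g.r = (Z.s E1.e).r ^ q * (Z.wordS w).r * (Z.s a).r * (Z.s E2.e).r ^ k' := by
    simp only [hg, SimP.mul, SimP.pow_r, hW, wordS_rep]; ring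
  have hz1C : E1.z ∉ (Z.wordS W).fT '' Y := by
    rcases hz with ⟨h1, _⟩ | ⟨h1, _⟩ <;> rw [h1]
    · exact c1.2.2
    · exact c1.2.1
  have hqN : 1 ≤ q * (N + 1) := Nat.mul_pos hq (Nat.succ_pos N)
  have hqN2 : N + 1 ≤ q * (N + 1) := Nat.le_mul_of_pos_left _ hq
  have hpN : 1 ≤ p * (N + 1) := Nat.mul_pos hp (Nat.succ_pos N)
  refine ⟨q * (N + 1) + p * (N + 1) + N, g, q * (N + 1), p * (N + 1), hqN, ?_, ?_, ?_, ?_, ?_, ?_, ?_, ?_,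
    ?_, ?_⟩
  · omega
  · omega
  · rw [pow_mul, pow_mul, hqp]
  · exact mul_pos (wordS_pos W hWn) (mul_pos (Z.rpos _ ha) (E2.pow_pos k'))
  · refine mul_le_one₀ (wordS_le W hWn) (mul_pos (Z.rpos _ ha) (E2.pow_pos k')).le ?_
    exact mul_le_one₀ (Z.rlt _ ha).le (E2.pow_pos k').le (E2.pow_le k')
  · rw [gC, hW]
    obtain ⟨q, rfl⟩ : ∃ q', q = q' + 1 := ⟨q - 1, by omega⟩
    rw [List.replicate_succ, List.cons_append, wordS, SimP.mul_fT_image]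
    refine (Set.image_mono ?_).trans E1.eR
    refine ((hinn.word hYl (List.replicate q E1.e ++ w) ?_).1).1
    intro c hc
    refine hWn c ?_
    rw [hW, List.replicate_succ, List.cons_append]
    exact List.mem_cons_of_mem _ hc
  · rw [gC, c3, hYt, E2.RR_tau, hg, SimP.mul_fD_image, SimP.mul_fD_image]
  · rw [gC]; exact c2.mono (by omega)
  · rw [gC, Set.disjoint_left]
    have := E1.RR_min (q * (N + 1)) _ (c2.compl.mono (by omega)) hz1C
    exact fun x hx => this hx
  · intro K
    refine ⟨q * (N + 1) * K, k + p + p * (N + 1) * K, Nat.le_mul_of_pos_left _ hqN, ?_, ?_⟩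
    · have := Nat.le_mul_of_pos_left K hpN
      omega
    · rw [gr, pow_add, pow_add, mul_assoc p, mul_assoc q, pow_mul (Z.s E2.e).r p,
        pow_mul (Z.s E1.e).r q, hqp]
      linear_combination ((Z.s E2.e).r ^ p * ((Z.s E2.e).r ^ p) ^ ((N + 1) * K)) * heq

end Sys

/-! ### Part 4: construction of the system -/

lemma ifs_order {n : ℕ} {r t : ℕ → ℝ} (hr : ∀ i, i < n → 0 < r i) (δ : ℝ) (hδ : 0 ≤ δ)
    (ho : ∀ i, i + 1 < n → r i + t i + δ ≤ t (i + 1)) :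
    ∀ j k, j < k → k < n → r j + t j + δ ≤ t k := by
  intro j k hjk
  induction hjk with
  | refl => exact fun h => ho j h
  | @step k hjk ih =>
    intro h
    have h1 := ih (by omega)
    have h2 := ho k h
    have h3 := hr k (by omega)
    linarith

lemma ifs_unit {n : ℕ} {r t : ℕ → ℝ} (hn : 1 ≤ n) (hr : ∀ i, i < n → 0 < r i)
    (ho : ∀ i, i + 1 < n → r i + t i ≤ t (i + 1)) (h0 : t 0 = 0) (h1 : r (n - 1) + t (n - 1) = 1) :
    ∀ j, j < n → 0 ≤ t j ∧ r j + t j ≤ 1 := by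
  have := ifs_order hr 0 le_rfl (by simpa using ho)
  intro j hj
  constructor
  · rcases Nat.eq_zero_or_pos j with rfl | h
    · exact h0.ge
    · have h2 := this 0 j h hj
      have h3 := hr 0 (by omega)
      linarith
  · rcases Nat.lt_or_ge j (n - 1) with h | h
    · have h2 := this j (n - 1) h (by omega)
      have h3 := hr (n - 1) (by omega)
      linarith
    · obtain rfl : j = n - 1 := by omega
      exact h1.le

lemma ifs_Icc {n : ℕ} {r t : ℕ → ℝ} {K : Set ℝ} (hK : IsCompact K) (hne : K.Nonempty)
    (hr : ∀ i, i < n → 0 < r i) (hr1 : ∀ i, i < n → r i < 1)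
    (hu : ∀ j, j < n → 0 ≤ t j ∧ r j + t j ≤ 1)
    (hinv : ∀ x, x ∈ K ↔ ∃ c, c < n ∧ ∃ y ∈ K, r c * y + t c = x) : ∀ x ∈ K, 0 ≤ x ∧ x ≤ 1 := by
  obtain ⟨M, hM, hM'⟩ := hK.exists_isGreatest hne
  obtain ⟨m, hm, hm'⟩ := hK.exists_isLeast hne
  have h1 : M ≤ 1 := by
    obtain ⟨c, hc, y, hy, hyM⟩ := (hinv M).1 hM
    have h2 := hM' hy
    have h3 := hr c hc
    have h4 := hr1 c hc
    have h5 := hu c hc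
    by_contra h6
    push Not at h6
    nlinarith
  have h2 : 0 ≤ m := by
    obtain ⟨c, hc, y, hy, hyM⟩ := (hinv m).1 hm
    have h2 := hm' hy
    have h3 := hr c hc
    have h4 := hr1 c hc
    have h5 := hu c hc
    by_contra h6
    push Not at h6
    nlinarith
  exact fun x hx => ⟨h2.trans (hm' hx), (hM' hx).trans h1⟩

lemma ifs_fix {K : Set ℝ} (hK : IsClosed K) (hne : K.Nonempty) {a b z : ℝ} (ha : 0 < a) (ha1 : a < 1)
    (hm : ∀ x ∈ K, a * x + b ∈ K) (hz : a * z + b = z) : z ∈ K := by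
  obtain ⟨x, hx⟩ := hne
  have h : ∀ k : ℕ, z + a ^ k * (x - z) ∈ K := by
    intro k
    induction k with
    | zero => simpa using hx
    | succ k ih =>
      have := hm _ ih
      convert this using 1
      rw [pow_succ]
      linear_combination -hz
  refine hK.mem_of_tendsto (f := fun k : ℕ => z + a ^ k * (x - z)) (b := Filter.atTop) ?_
    (Filter.Eventually.of_forall h)
  have := ((tendsto_pow_atTop_nhds_zero_of_lt_one ha.le ha1).mul_const (x - z)).const_add z
  simpa using this

/-- The coding map from the dust-like set to the touching set. -/
lemma coding_exists {n : ℕ} {r t d : ℕ → ℝ} {T D : Set ℝ} (hT : IsClosed T) (h0T : (0 : ℝ) ∈ T)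
    (hr : ∀ i, i < n → 0 < r i) (R : ℝ) (hR1 : R < 1) (hrR : ∀ i, i < n → r i ≤ R)
    (hR0 : 0 ≤ R)
    (hu : ∀ j, j < n → 0 ≤ t j ∧ t j ≤ 1)
    (hinvT : ∀ c, c < n → ∀ y ∈ T, r c * y + t c ∈ T)
    (hinvD : ∀ x, x ∈ D ↔ ∃ c, c < n ∧ ∃ y ∈ D, r c * y + d c = x)
    (dD : ∀ c, c < n → ∀ c', c' < n → ∀ x ∈ D, ∀ y ∈ D, r c * x + d c = r c' * y + d c' → c = c') :
    ∃ θ : ℝ → ℝ, (∀ y ∈ D, θ y ∈ T) ∧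
      ∀ c, c < n → ∀ y ∈ D, θ (r c * y + d c) = r c * θ y + t c := by
  choose! j hj s hs hjs using fun x (hx : x ∈ D) => (hinvD x).1 hx
  let term : ℝ → ℕ → ℝ := fun y k => (∏ m ∈ Finset.range k, r (j (s^[m] y))) * t (j (s^[k] y))
  have hit : ∀ k, ∀ y ∈ D, s^[k] y ∈ D := by
    intro k
    induction k with
    | zero => exact fun y hy => hy
    | succ k ih =>
      intro y hy
      rw [Function.iterate_succ_apply]
      exact ih _ (hs y hy)
  have hb : ∀ y ∈ D, ∀ k, 0 ≤ term y k ∧ term y k ≤ R ^ k := by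
    intro y hy k
    have h1 : 0 ≤ ∏ m ∈ Finset.range k, r (j (s^[m] y)) :=
      Finset.prod_nonneg fun m _ => (hr _ (hj _ (hit m y hy))).le
    have h2 : ∏ m ∈ Finset.range k, r (j (s^[m] y)) ≤ R ^ k := by
      calc ∏ m ∈ Finset.range k, r (j (s^[m] y)) ≤ ∏ m ∈ Finset.range k, R :=
            Finset.prod_le_prod (fun m _ => (hr _ (hj _ (hit m y hy))).le)
              fun m _ => hrR _ (hj _ (hit m y hy))
        _ = R ^ k := by simp
    have h3 := hu _ (hj _ (hit k y hy))
    refine ⟨mul_nonneg h1 h3.1, ?_⟩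
    calc term y k ≤ R ^ k * 1 := mul_le_mul h2 h3.2 h3.1 (pow_nonneg hR0 k)
      _ = R ^ k := mul_one _
  have hgeo := summable_geometric_of_lt_one hR0 hR1
  have hsum : ∀ y ∈ D, Summable (term y) := fun y hy =>
    Summable.of_nonneg_of_le (fun k => (hb y hy k).1) (fun k => (hb y hy k).2) hgeo
  let θ : ℝ → ℝ := fun y => ∑' k, term y k
  have hrec : ∀ y ∈ D, θ y = r (j y) * θ (s y) + t (j y) := by
    intro y hy
    have h1 : ∀ k, term y (k + 1) = r (j y) * term (s y) k := by
      intro k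
      simp only [term, Finset.prod_range_succ', Function.iterate_succ_apply, Function.iterate_zero, id]
      ring
    have h2 : term y 0 = t (j y) := by simp [term]
    simp only [θ]
    rw [(hsum y hy).tsum_eq_zero_add, h2]
    simp only [h1]
    rw [tsum_mul_left]
    ring
  have hbd : ∀ y ∈ D, |θ y| ≤ ∑' k, R ^ k := by
    intro y hy
    rw [abs_of_nonneg (tsum_nonneg fun k => (hb y hy k).1)]
    exact Summable.tsum_le_tsum (fun k => (hb y hy k).2) (hsum y hy) hgeo
  refine ⟨θ, ?_, ?_⟩
  · have happ : ∀ k : ℕ, ∀ y ∈ D, ∃ x ∈ T, |θ y - x| ≤ R ^ k * ∑' k, R ^ k := by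
      intro k
      induction k with
      | zero => exact fun y hy => ⟨0, h0T, by simpa using hbd y hy⟩
      | succ k ih =>
        intro y hy
        obtain ⟨x, hx, hxy⟩ := ih (s y) (hs y hy)
        refine ⟨r (j y) * x + t (j y), hinvT _ (hj y hy) x hx, ?_⟩
        rw [hrec y hy, show r (j y) * θ (s y) + t (j y) - (r (j y) * x + t (j y)) =
          r (j y) * (θ (s y) - x) by ring, abs_mul, abs_of_pos (hr _ (hj y hy)), pow_succ]
        calc r (j y) * |θ (s y) - x| ≤ R * (R ^ k * ∑' k, R ^ k) :=
              mul_le_mul (hrR _ (hj y hy)) hxy (abs_nonneg _) hR0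
          _ = R ^ k * R * ∑' k, R ^ k := by ring
    intro y hy
    rw [← hT.closure_eq, Metric.mem_closure_iff]
    intro ε hε
    have hlim := (tendsto_pow_atTop_nhds_zero_of_lt_one hR0 hR1).mul_const (∑' k, R ^ k)
    rw [zero_mul] at hlim
    obtain ⟨k, hk⟩ := (hlim.eventually (gt_mem_nhds hε)).exists
    obtain ⟨x, hx, hxy⟩ := happ k y hy
    exact ⟨x, hx, lt_of_le_of_lt hxy hk⟩
  · intro c hc y hy
    have hY : r c * y + d c ∈ D := (hinvD _).2 ⟨c, hc, y, hy, rfl⟩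
    have h1 := hjs _ hY
    have h2 : j (r c * y + d c) = c := dD _ (hj _ hY) c hc _ (hs _ hY) y hy h1
    rw [h2] at h1
    have h3 : s (r c * y + d c) = y := by
      have : r c * s (r c * y + d c) = r c * y := by linarith
      exact mul_left_cancel₀ (hr c hc).ne' this
    rw [hrec _ hY, h2, h3]

lemma sys_exists {n : ℕ} {ρ : ℕ → ℝ} (hρ : ContractionVec n ρ) (S : TouchingIFS n ρ) (Q : DustIFS n ρ) :
    ∃ Z : Sys n, Z.T = S.T ∧ Z.D = Q.D ∧ (∀ c, Z.s c = ⟨ρ c, S.t c, Q.d c⟩) ∧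
      ∀ j, Z.touch j ↔ S.touch j := by
  have hn := hρ.three_le
  have S0 : S.t 0 = 0 := by simpa [affMap] using S.left0
  have S1 : ρ (n - 1) + S.t (n - 1) = 1 := by simpa [affMap] using S.right1
  have Q0 : Q.d 0 = 0 := by simpa [affMap] using Q.left0
  have Q1 : ρ (n - 1) + Q.d (n - 1) = 1 := by simpa [affMap] using Q.right1
  have So : ∀ i, i + 1 < n → ρ i + S.t i ≤ S.t (i + 1) := by
    intro i hi; simpa [affMap] using S.order i hi
  set δ := (1 - ∑ j ∈ Finset.range n, ρ j) / ((n : ℝ) - 1) with hδ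
  have hδ0 : 0 < δ := by
    have h3 : (3 : ℝ) ≤ n := by exact_mod_cast hn
    exact div_pos (by linarith [hρ.sum_lt]) (by linarith)
  have Qo : ∀ i, i + 1 < n → ρ i + Q.d i + δ ≤ Q.d (i + 1) := by
    intro i hi
    have := Q.equal_gap i hi
    simp only [affMap, mul_zero, zero_add, mul_one] at this
    linarith
  have Qo' : ∀ i, i + 1 < n → ρ i + Q.d i ≤ Q.d (i + 1) := fun i hi => by linarith [Qo i hi]
  have SO := ifs_order hρ.pos 0 le_rfl (by simpa using So)
  have QO := ifs_order hρ.pos δ hδ0.le Qo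
  have SU := ifs_unit (by omega) hρ.pos So S0 S1
  have QU := ifs_unit (by omega) hρ.pos Qo' Q0 Q1
  have SI : ∀ x, x ∈ S.T ↔ ∃ c, c < n ∧ ∃ y ∈ S.T, ρ c * y + S.t c = x := by
    intro x
    conv_lhs => rw [S.invT]
    simp only [Set.mem_iUnion, Finset.mem_range, exists_prop, Set.mem_image, affMap]
  have QI : ∀ x, x ∈ Q.D ↔ ∃ c, c < n ∧ ∃ y ∈ Q.D, ρ c * y + Q.d c = x := by
    intro x
    conv_lhs => rw [Q.invD]
    simp only [Set.mem_iUnion, Finset.mem_range, exists_prop, Set.mem_image, affMap]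
  have SB := ifs_Icc S.compactT S.nonemptyT hρ.pos hρ.lt_one SU SI
  have QB := ifs_Icc Q.compactD Q.nonemptyD hρ.pos hρ.lt_one QU QI
  have h0T : (0 : ℝ) ∈ S.T := by
    refine ifs_fix S.compactT.isClosed S.nonemptyT (hρ.pos 0 (by omega)) (hρ.lt_one 0 (by omega))
      (b := S.t 0) (fun x hx => (SI _).2 ⟨0, by omega, x, hx, rfl⟩) (by rw [S0]; ring)
  have h1T : (1 : ℝ) ∈ S.T := by
    refine ifs_fix S.compactT.isClosed S.nonemptyT (hρ.pos (n - 1) (by omega))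
      (hρ.lt_one (n - 1) (by omega))
      (b := S.t (n - 1)) (fun x hx => (SI _).2 ⟨n - 1, by omega, x, hx, rfl⟩) (by rw [mul_one]; exact S1)
  have dD : ∀ c, c < n → ∀ c', c' < n → ∀ x ∈ Q.D, ∀ y ∈ Q.D,
      ρ c * x + Q.d c = ρ c' * y + Q.d c' → c = c' := by
    have key : ∀ c c', c < c' → c' < n → ∀ x ∈ Q.D, ∀ y ∈ Q.D,
        ρ c * x + Q.d c ≠ ρ c' * y + Q.d c' := by
      intro c c' h h' x hx y hy hxy
      have h1 := QO c c' h h'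
      have h2 := mul_le_mul_of_nonneg_left (QB x hx).2 (hρ.pos c (by omega)).le
      have h3 := mul_nonneg (hρ.pos c' h').le (QB y hy).1
      linarith
    intro c hc c' hc' x hx y hy hxy
    rcases lt_trichotomy c c' with h | h | h
    · exact (key c c' h hc' x hx y hy hxy).elim
    · exact h
    · exact (key c' c h hc y hy x hx hxy.symm).elim
  obtain ⟨θ, θT, θeq⟩ := coding_exists S.compactT.isClosed h0T hρ.pos (∑ i ∈ Finset.range n, ρ i)
    hρ.sum_lt (fun i hi => Finset.single_le_sum (f := ρ)
      (fun i hi => (hρ.pos i (Finset.mem_range.1 hi)).le) (Finset.mem_range.2 hi))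
    (Finset.sum_nonneg fun i hi => (hρ.pos i (Finset.mem_range.1 hi)).le)
    (fun j hj => ⟨(SU j hj).1, by linarith [(SU j hj).2, hρ.pos j hj]⟩)
    (fun c hc y hy => (SI _).2 ⟨c, hc, y, hy, rfl⟩) QI dD
  refine ⟨{
    s := fun c => ⟨ρ c, S.t c, Q.d c⟩
    T := S.T
    D := Q.D
    θ := θ
    touch := S.touch
    npos := by omega
    rpos := hρ.pos
    rlt := hρ.lt_one
    cT := S.compactT
    cD := Q.compactD
    neD := Q.nonemptyD
    invT := SI
    invD := QI
    θT := θT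
    θeq := θeq
    dD := dD
    zT := h0T
    oT := h1T
    sep := ?_
    tch := ?_
    fix0 := S.left0
    fix1 := S.right1 }, rfl, rfl, fun _ => rfl, fun _ => Iff.rfl⟩
  · intro j c hjc hc y hy x hx hxy
    simp only [SimP.fT] at hxy
    have pj := hρ.pos j (by omega)
    have pc := hρ.pos c hc
    have h1 := mul_le_mul_of_nonneg_left (SB y hy).2 pj.le
    have h2 := mul_nonneg pc.le (SB x hx).1
    have h3 := So j (by omega)
    have h4 : c = j + 1 := by
      by_contra hne
      have h5 := SO (j + 1) c (by omega) hc
      have h6 := hρ.pos (j + 1) (by omega)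
      linarith
    subst h4
    refine ⟨rfl, ⟨hc, ?_⟩, ?_, ?_⟩
    · simp only [affMap]
      linarith
    · have : ρ j * y = ρ j * 1 := by linarith
      exact mul_left_cancel₀ pj.ne' this
    · have : ρ (j + 1) * x = ρ (j + 1) * 0 := by linarith
      exact mul_left_cancel₀ pc.ne' this
  · exact fun j hj => hj

/-! ### Part 5: end pieces and conclusion -/

namespace Sys

variable {n : ℕ} (Z : Sys n)

lemma free_zero {a : ℕ} (ha : a < n) (h : ∀ c, Z.touch c → a ≠ c + 1) : Z.Free 0 a := by
  intro c hc hca x hx y hy hxy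
  rcases lt_or_gt_of_ne hca with h1 | h1
  · obtain ⟨h2, h3, -, -⟩ := Z.sep c a h1 ha x hx y hy hxy
    exact (h c h3 h2).elim
  · obtain ⟨-, -, h4, -⟩ := Z.sep a c h1 hc y hy x hx hxy.symm
    rw [h4]; norm_num

lemma free_one {a : ℕ} (ha : a < n) (h : ¬ Z.touch a) : Z.Free 1 a := by
  intro c hc hca x hx y hy hxy
  rcases lt_or_gt_of_ne hca with h1 | h1
  · obtain ⟨-, -, -, h4⟩ := Z.sep c a h1 ha x hx y hy hxy
    rw [h4]; norm_num
  · obtain ⟨-, h3, -, -⟩ := Z.sep a c h1 hc y hy x hx hxy.symm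
    exact (h h3).elim

lemma left_end {α : ℕ} (h1 : 1 ≤ α) (h2 : α < n) (h3 : ∀ i, i + 1 < α → Z.touch i)
    (h4 : ¬ Z.touch (α - 1)) :
    ∃ B : Z.EndD, B.z = 0 ∧ B.e = 0 ∧ B.R = ⋃ j ∈ Finset.range α, (Z.s j).fT '' Z.T := by
  have hmem : ∀ x, x ∈ (⋃ j ∈ Finset.range α, (Z.s j).fT '' Z.T) ↔
      ∃ j, j < α ∧ ∃ y ∈ Z.T, (Z.s j).fT y = x := by
    intro x; simp only [Set.mem_iUnion, Finset.mem_range, exists_prop, Set.mem_image]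
  refine ⟨{ z := 0, e := 0, R := ⋃ j ∈ Finset.range α, (Z.s j).fT '' Z.T,
            zne := by norm_num, en := by omega, hz := Z.fix0, zT := Z.zT, RT := ?_, lev1 := ?_,
            zR := ?_, zR' := ?_, min := ?_, eR := ?_, free := ?_ }, rfl, rfl, rfl⟩
  · intro x hx
    obtain ⟨j, hj, y, hy, rfl⟩ := (hmem x).1 hx
    exact Z.mapT (by omega) hy
  · intro c hc
    rcases Nat.lt_or_ge c α with h | h
    · left
      intro x hx
      exact (hmem _).2 ⟨c, h, x, hx, rfl⟩
    · right
      rw [Set.disjoint_left]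
      intro x hx hx'
      obtain ⟨j, hj, y, hy, hyx⟩ := (hmem _).1 hx'
      obtain ⟨h5, h6, -, -⟩ := Z.sep j c (by omega) hc y hy x hx hyx
      obtain rfl : j = α - 1 := by omega
      exact h4 h6
  · exact (hmem _).2 ⟨0, by omega, 0, Z.zT, Z.fix0⟩
  · intro hx
    obtain ⟨j, hj, y, hy, hyx⟩ := (hmem _).1 hx
    rw [sub_zero, ← Z.fix1] at hyx
    obtain ⟨h5, h6, -, -⟩ := Z.sep j (n - 1) (by omega) (by omega) y hy 1 Z.oT hyx
    obtain rfl : j = α - 1 := by omega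
    exact h4 h6
  · intro X hX h0
    have key : ∀ j, j < α → (Z.s j).fT 0 ∈ X → ∀ y ∈ Z.T, (Z.s j).fT y ∈ X := by
      intro j hj hx
      rcases hX j (by omega) with h | h
      · exact fun y hy => h hy
      · exact (Set.disjoint_left.1 h Z.zT hx).elim
    have key2 : ∀ j, j < α → (Z.s j).fT 0 ∈ X := by
      intro j
      induction j with
      | zero => intro _; rw [Z.fix0]; exact h0
      | succ j ih =>
        intro hj
        rw [← (Z.tch j (h3 j hj)).2]
        exact key j (by omega) (ih (by omega)) 1 Z.oT
    intro x hx
    obtain ⟨j, hj, y, hy, rfl⟩ := (hmem x).1 hx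
    exact key j hj (key2 j hj) y hy
  · rintro _ ⟨y, hy, rfl⟩
    exact (hmem _).2 ⟨0, by omega, y, hy, rfl⟩
  · exact Z.free_zero (by omega) fun c _ => by omega

lemma right_end {β : ℕ} (h1 : 1 ≤ β) (h2 : β < n) (h3 : ∀ i, n - β ≤ i → i + 1 < n → Z.touch i)
    (h4 : ¬ Z.touch (n - β - 1)) :
    ∃ A : Z.EndD, A.z = 1 ∧ A.e = n - 1 ∧ A.R = ⋃ j ∈ Finset.Ico (n - β) n, (Z.s j).fT '' Z.T := by
  have hmem : ∀ x, x ∈ (⋃ j ∈ Finset.Ico (n - β) n, (Z.s j).fT '' Z.T) ↔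
      ∃ j, (n - β ≤ j ∧ j < n) ∧ ∃ y ∈ Z.T, (Z.s j).fT y = x := by
    intro x; simp only [Set.mem_iUnion, Finset.mem_Ico, exists_prop, Set.mem_image]
  refine ⟨{ z := 1, e := n - 1, R := ⋃ j ∈ Finset.Ico (n - β) n, (Z.s j).fT '' Z.T,
            zne := by norm_num, en := by omega, hz := Z.fix1, zT := Z.oT, RT := ?_, lev1 := ?_,
            zR := ?_, zR' := ?_, min := ?_, eR := ?_, free := ?_ }, rfl, rfl, rfl⟩
  · intro x hx
    obtain ⟨j, hj, y, hy, rfl⟩ := (hmem x).1 hx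
    exact Z.mapT (by omega) hy
  · intro c hc
    rcases Nat.lt_or_ge c (n - β) with h | h
    · right
      rw [Set.disjoint_left]
      intro x hx hx'
      obtain ⟨j, hj, y, hy, hyx⟩ := (hmem _).1 hx'
      obtain ⟨h5, h6, -, -⟩ := Z.sep c j (by omega) hj.2 x hx y hy hyx.symm
      obtain rfl : c = n - β - 1 := by omega
      exact h4 h6
    · left
      intro x hx
      exact (hmem _).2 ⟨c, ⟨h, hc⟩, x, hx, rfl⟩
  · exact (hmem _).2 ⟨n - 1, by omega, 1, Z.oT, Z.fix1⟩
  · intro hx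
    obtain ⟨j, hj, y, hy, hyx⟩ := (hmem _).1 hx
    rw [sub_self, ← Z.fix0] at hyx
    obtain ⟨h5, h6, -, -⟩ := Z.sep 0 j (by omega) (by omega) 0 Z.zT y hy hyx.symm
    have h7 : n - β - 1 = 0 := by omega
    rw [h7] at h4
    exact h4 h6
  · intro X hX h0
    have key : ∀ j, j < n → (Z.s j).fT 1 ∈ X → ∀ y ∈ Z.T, (Z.s j).fT y ∈ X := by
      intro j hj hx
      rcases hX j (by omega) with h | h
      · exact fun y hy => h hy
      · exact (Set.disjoint_left.1 h Z.oT hx).elim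
    have key2 : ∀ m j, j + m = n - 1 → n - β ≤ j → (Z.s j).fT 1 ∈ X := by
      intro m
      induction m with
      | zero =>
        intro j hj _
        obtain rfl : j = n - 1 := by omega
        rw [Z.fix1]; exact h0
      | succ m ih =>
        intro j hj hj'
        rw [(Z.tch j (h3 j hj' (by omega))).2]
        exact key (j + 1) (by omega) (ih (j + 1) (by omega) (by omega)) 0 Z.zT
    intro x hx
    obtain ⟨j, hj, y, hy, rfl⟩ := (hmem x).1 hx
    exact key j hj.2 (key2 (n - 1 - j) j (by omega) hj.1) y hy
  · rintro _ ⟨y, hy, rfl⟩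
    exact (hmem _).2 ⟨n - 1, by omega, y, hy, rfl⟩
  · refine Z.free_one (by omega) fun h => ?_
    have := (Z.tch _ h).1
    omega

lemma diam_R_pos (E : Z.EndD) : 0 < Metric.diam E.R := by
  have h0 : (Z.s E.e).fT 0 ∈ E.R := E.eR ⟨0, Z.zT, rfl⟩
  have h1 : (Z.s E.e).fT 1 ∈ E.R := E.eR ⟨1, Z.oT, rfl⟩
  refine lt_of_lt_of_le ?_ (Metric.dist_le_diam_of_mem E.compactR.1.isBounded h0 h1)
  rw [SimP.dist_fT _ (Z.rpos _ E.en)]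
  exact mul_pos (Z.rpos _ E.en) (by norm_num)

lemma wordS_append_r (v w : List ℕ) : (Z.wordS (v ++ w)).r = (Z.wordS v).r * (Z.wordS w).r := by
  induction v with
  | nil => simp [wordS]
  | cons c v ih => rw [List.cons_append, wordS, wordS, SimP.mul, SimP.mul, ih]; ring

end Sys

lemma affWord_append (r t : ℕ → ℝ) (v w : List ℕ) (x : ℝ) :
    affWord r t (v ++ w) x = affWord r t v (affWord r t w x) := by
  induction v with
  | nil => rfl
  | cons c v ih => simp only [List.cons_append, affWord, Function.comp, ih]

lemma diam_image_smul {f : ℝ → ℝ} {r : ℝ} (hr : 0 ≤ r) (hf : ∀ x y, dist (f x) (f y) = r * dist x y)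
    {X : Set ℝ} (hX : Bornology.IsBounded X) : Metric.diam (f '' X) = r * Metric.diam X := by
  rcases hr.eq_or_lt with rfl | hr'
  · rw [zero_mul]
    apply Metric.diam_subsingleton
    rintro _ ⟨x, _, rfl⟩ _ ⟨y, _, rfl⟩
    have := hf x y
    rw [zero_mul] at this
    exact dist_eq_zero.1 this
  apply le_antisymm
  · apply Metric.diam_le_of_forall_dist_le (mul_nonneg hr Metric.diam_nonneg)
    rintro _ ⟨x, hx, rfl⟩ _ ⟨y, hy, rfl⟩
    rw [hf]
    exact mul_le_mul_of_nonneg_left (Metric.dist_le_diam_of_mem hX hx hy) hr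
  · have hb : Bornology.IsBounded (f '' X) := by
      rw [Metric.isBounded_iff] at hX ⊢
      obtain ⟨C, hC⟩ := hX
      refine ⟨r * C, ?_⟩
      rintro _ ⟨x, hx, rfl⟩ _ ⟨y, hy, rfl⟩
      rw [hf]
      exact mul_le_mul_of_nonneg_left (hC hx hy) hr
    rw [← le_div_iff₀' hr']
    apply Metric.diam_le_of_forall_dist_le (div_nonneg Metric.diam_nonneg hr)
    intro x hx y hy
    rw [le_div_iff₀' hr', ← hf]
    exact Metric.dist_le_diam_of_mem hb ⟨x, hx, rfl⟩ ⟨y, hy, rfl⟩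

lemma affWord_dist {n : ℕ} {ρ : ℕ → ℝ} {t d : ℕ → ℝ} (Z : Sys n) (hs : ∀ c, Z.s c = ⟨ρ c, t c, d c⟩)
    (v : List ℕ) (hv : ∀ c ∈ v, c < n) (x y : ℝ) :
    dist (affWord ρ t v x) (affWord ρ t v y) = (Z.wordS v).r * dist x y := by
  have : affWord ρ t v = (Z.wordS v).fT := by
    clear hv
    induction v with
    | nil => funext x; simp [affWord, Sys.wordS, SimP.fT]
    | cons c v ih =>
      funext x
      simp only [affWord, Function.comp, ih, Sys.wordS, SimP.fT, SimP.mul, affMap, hs]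
      ring
  rw [this]
  exact SimP.dist_fT _ (Z.wordS_pos v hv) x y

lemma affWord_patch {n : ℕ} {ρ : ℕ → ℝ} {S : TouchingIFS n ρ} {d : ℕ → ℝ} (Z : Sys n) (hT : Z.T = S.T)
    (hs : ∀ c, Z.s c = ⟨ρ c, S.t c, d c⟩) (J : Finset ℕ) (v : List ℕ) (hv : ∀ c ∈ v, c < n) (E : Z.EndD)
    (hE : E.R = ⋃ j ∈ J, (Z.s j).fT '' Z.T) :
    Metric.diam (⋃ j ∈ J, S.cyl (v ++ [j])) = (Z.wordS v).r * Metric.diam E.R := by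
  have h1 : (⋃ j ∈ J, S.cyl (v ++ [j])) = affWord ρ S.t v '' E.R := by
    rw [hE]
    simp only [Set.image_iUnion, TouchingIFS.cyl, hT]
    refine Set.iUnion_congr fun j => Set.iUnion_congr fun _ => ?_
    rw [Set.image_image]
    refine Set.image_congr fun x _ => ?_
    rw [affWord_append]
    simp only [affWord, Function.comp, id, affMap, hs, SimP.fT]
  rw [h1]
  exact diam_image_smul (Z.wordS_pos v hv).le (affWord_dist Z hs v hv) E.compactR.1.isBounded

lemma log_ratio {x y : ℝ} (hx : 0 < x) (hx1 : x < 1) (hy : 0 < y) (hy1 : y < 1) {q : ℚ}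
    (h : Real.log x / Real.log y = (q : ℝ)) : ∃ a b : ℕ, 1 ≤ a ∧ 1 ≤ b ∧ x ^ a = y ^ b := by
  have lx := Real.log_neg hx hx1
  have ly := Real.log_neg hy hy1
  have hq : (0 : ℝ) < q := h ▸ div_pos_of_neg_of_neg lx ly
  have hq' : 0 < q := by exact_mod_cast hq
  have hnum : 0 < q.num := Rat.num_pos.2 hq'
  obtain ⟨m, hm⟩ := Int.eq_ofNat_of_zero_le hnum.le
  refine ⟨q.den, m, q.pos, by omega, ?_⟩
  apply Real.log_injOn_pos (Set.mem_Ioi.2 (pow_pos hx _)) (Set.mem_Ioi.2 (pow_pos hy _))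
  rw [Real.log_pow, Real.log_pow]
  rw [Rat.cast_def, hm] at h
  have hd : (q.den : ℝ) ≠ 0 := by exact_mod_cast q.den_nz
  rw [div_eq_div_iff ly.ne hd] at h
  push_cast at h
  linarith

/-- Theorem 1.3: if `log ρ₁ / log ρₙ ∈ ℚ` and every touching letter is
substitutable, then `D ∼ T`. -/
theorem lipEquiv_of_substitutable {n : ℕ} {ρ : ℕ → ℝ}
    (hρ : ContractionVec n ρ) (S : TouchingIFS n ρ) (Q : DustIFS n ρ)
    (α β : ℕ) (hα : S.alphaRun α) (hβ : S.betaRun β)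
    (hlog : ∃ q : ℚ, Real.log (ρ 0) / Real.log (ρ (n - 1)) = (q : ℝ))
    (hsub : ∀ i, S.touch i → S.LeftSub α i ∨ S.RightSub β i) :
    LipEquivOn Q.D S.T := by
  obtain ⟨Z, hT, hD, hs, ht⟩ := sys_exists hρ S Q
  have hn := hρ.three_le
  obtain ⟨a1, a2, a3, a4⟩ := hα
  obtain ⟨b1, b2, b3, b4⟩ := hβ
  obtain ⟨B, Bz, Be, BR⟩ := Z.left_end a1 a2 (fun i hi => (ht i).2 (a3 i hi)) (fun h => a4 ((ht _).1 h))
  obtain ⟨A, Az, Ae, AR⟩ := Z.right_end b1 b2 (fun i hi hi' => (ht i).2 (b3 i hi hi'))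
    (fun h => b4 ((ht _).1 h))
  obtain ⟨q0, hq0⟩ := hlog
  obtain ⟨p, q, hp, hq, hpq⟩ := log_ratio (hρ.pos 0 (by omega)) (hρ.lt_one 0 (by omega))
    (hρ.pos (n - 1) (by omega)) (hρ.lt_one (n - 1) (by omega)) hq0
  have rB : (Z.s B.e).r = ρ 0 := by rw [Be, hs]
  have rA : (Z.s A.e).r = ρ (n - 1) := by rw [Ae, hs]
  have wr : ∀ (i : ℕ) (w : List ℕ) (a : ℕ) (e k : ℕ),
      (Z.wordS (i :: (w ++ [a]) ++ List.replicate k e)).r =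
        (Z.s i).r * (Z.wordS w).r * (Z.s a).r * (Z.s e).r ^ k := by
    intro i w a e k
    have h1 := Z.wordS_rep e k []
    rw [List.append_nil] at h1
    rw [Z.wordS_append_r, h1]
    simp only [Sys.wordS, SimP.mul, Z.wordS_append_r]
    ring
  have wr1 : ∀ (i e k : ℕ),
      (Z.wordS ([i] ++ List.replicate k e)).r = (Z.s i).r * (Z.s e).r ^ k := by
    intro i e k
    have h1 := Z.wordS_rep e k []
    rw [List.append_nil] at h1
    rw [Z.wordS_append_r, h1]
    simp only [Sys.wordS, SimP.mul]
    ring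
  rw [← hT, ← hD]
  refine Sys.sys_main A B Az Bz fun i hi => ?_
  have hin := (Z.tch i hi).1
  rcases hsub i ((ht i).1 hi) with ⟨w, a, k, k', hw, hd, ha0, hat⟩ | ⟨w, a, k, k', hw, hd, ha0, hat⟩
  · have haw : a < n := hw a (by simp)
    have hww : ∀ c ∈ w, c < n := fun c hc => hw c (by simp [hc])
    have hrep : ∀ m, ∀ c ∈ List.replicate m 0, c < n := by
      intro m c hc; rw [List.eq_of_mem_replicate hc]; omega
    unfold TouchingIFS.patchL at hd
    rw [affWord_patch Z hT hs _ _ ?_ B BR, affWord_patch Z hT hs _ _ ?_ B BR] at hd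
    · have hd := mul_right_cancel₀ (Z.diam_R_pos B).ne' hd
      rw [wr, wr1, ← Be] at hd
      obtain ⟨Nb, g, q', p', h⟩ := Sys.subst_exists A B (Or.inl ⟨Az, Bz⟩) hq hp (by rw [rA, rB, hpq]) w hww
        haw (by rw [Bz]; exact Z.free_zero haw fun c hc => hat c ((ht c).1 hc)) (by rw [Be]; exact ha0) hd
      exact ⟨Nb, g, q', p', Or.inl h⟩
    · intro c hc
      rcases List.mem_append.1 hc with hc | hc
      · rcases List.mem_cons.1 hc with rfl | hc
        · omega
        · exact hw c hc
      · exact hrep _ c hc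
    · intro c hc
      rw [List.mem_append] at hc
      rcases hc with hc | hc
      · rw [List.mem_singleton.1 hc]; omega
      · exact hrep _ c hc
  · have haw : a < n := hw a (by simp)
    have hww : ∀ c ∈ w, c < n := fun c hc => hw c (by simp [hc])
    have hrep : ∀ m, ∀ c ∈ List.replicate m (n - 1), c < n := by
      intro m c hc; rw [List.eq_of_mem_replicate hc]; omega
    unfold TouchingIFS.patchR at hd
    rw [affWord_patch Z hT hs _ _ ?_ A AR, affWord_patch Z hT hs _ _ ?_ A AR] at hd
    · have hd := mul_right_cancel₀ (Z.diam_R_pos A).ne' hd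
      rw [wr, wr1, ← Ae] at hd
      obtain ⟨Nb, g, q', p', h⟩ := Sys.subst_exists B A (Or.inr ⟨Bz, Az⟩) hp hq (by rw [rA, rB, hpq]) w hww
        haw (by rw [Az]; exact Z.free_one haw fun hc => hat ((ht a).1 hc)) (by rw [Ae]; exact ha0) hd
      exact ⟨Nb, g, q', p', Or.inr h⟩
    · intro c hc
      rcases List.mem_append.1 hc with hc | hc
      · rcases List.mem_cons.1 hc with rfl | hc
        · omega
        · exact hw c hc
      · exact hrep _ c hc
    · intro c hc
      rw [List.mem_append] at hc
      rcases hc with hc | hc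
      · rw [List.mem_singleton.1 hc]; omega
      · exact hrep _ c hc
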